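/- arXiv:2502.05469 — 7 statements merged into one kernel-verified Lean document; each statement's English description precedes it below -/
import Mathlib

section
/- (Proposition 1.) The lifted support, i.e., the image G([l, v]), is the union of p line segments: G([l,v]) = ⋃_{j=1}^{p} K*_j, where K*_j = {λ·φ_{j−1} + (1−λ)·φ⁻_j : λ ∈ (0,1]} for j = 1,…,p−1 (a half-open segment containing G(w_{j−1}) and excluding the left limit φ⁻_j), and K*_p = {λ·φ_{p−1} + (1−λ)·φ⁻_p : λ ∈ [0,1]} (a closed segment). -/
/-- A finite sequence increasing at every step up to `p` is monotone up to `p`. -/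
theorem le_of_step_lt {p : ℕ} {w : ℕ → ℝ} (hw : ∀ j < p, w j < w (j + 1)) {i j : ℕ}
    (hij : i ≤ j) (hj : j ≤ p) : w i ≤ w j := by
  induction j, hij using Nat.le_induction with
  | base => exact le_rfl
  | succ n _ ih => exact (ih (by omega)).trans (hw n (by omega)).le

/-- Every point of `[w 0, w p]` lies in a cell of the subdivision: half-open, except the last. -/
theorem exists_cell {p : ℕ} (hp : 1 ≤ p) (w : ℕ → ℝ) {x : ℝ} (h0 : w 0 ≤ x) (hx : x ≤ w p) :
    ∃ n < p, w n ≤ x ∧ x ≤ w (n + 1) ∧ (n + 1 ≠ p → x < w (n + 1)) := by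
  induction p, hp using Nat.le_induction with
  | base => exact ⟨0, one_pos, h0, hx, by simp⟩
  | succ m hm ih =>
    rcases le_or_gt (w m) x with h | h
    · exact ⟨m, m.lt_succ_self, h, hx, by simp⟩
    · obtain ⟨n, hn, h1, h2, h3⟩ := ih h.le
      refine ⟨n, by omega, h1, h2, fun _ => ?_⟩
      by_cases hnm : n + 1 = m
      · rwa [hnm]
      · exact h3 hnm


/-- **Proposition 1.** The lifted support `G '' [l, v]` is the union of `p`
line segments: for `j = 1, …, p-1` the half-open segment
`{λ • φ (j-1) + (1-λ) • φ⁻ j : λ ∈ (0,1]}` (containing `G (w (j-1))`, excluding the left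
limit `φ⁻ j`), and for `j = p` the closed segment `{λ • φ (p-1) + (1-λ) • φ⁻ p : λ ∈ [0,1]}`. -/
theorem stmt_2 (p : ℕ) (hp : 1 ≤ p) (w : ℕ → ℝ)
    (hw : ∀ j < p, w j < w (j + 1))
    (V : ℕ → ℝ → ℝ)
    (hV1 : ∀ x : ℝ, V 1 x = min x (w 1))
    (hVj : ∀ j, 2 ≤ j → ∀ x : ℝ, V j x = max (min x (w j) - w (j - 1)) 0)
    (Q : ℕ → ℝ → ℝ)
    (hQ : ∀ j, ∀ x : ℝ, Q j x = if w j ≤ x then 1 else 0)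
    (G : ℝ → (Fin p → ℝ) × (Fin (p - 1) → ℝ))
    (hG : ∀ x : ℝ, G x = (fun j : Fin p => V ((j : ℕ) + 1) x,
        fun j : Fin (p - 1) => Q ((j : ℕ) + 1) x))
    (φ : ℕ → (Fin p → ℝ) × (Fin (p - 1) → ℝ))
    (hφ : ∀ j, φ j = G (w j))
    (φm : ℕ → (Fin p → ℝ) × (Fin (p - 1) → ℝ))
    (hφm : ∀ j, φm j = (fun k : Fin p => V ((k : ℕ) + 1) (w j),
        fun k : Fin (p - 1) => if (k : ℕ) + 1 < j then 1 else 0)) :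
    G '' Set.Icc (w 0) (w p)
      = ⋃ j ∈ Finset.Icc 1 p,
          (fun lam : ℝ => lam • φ (j - 1) + (1 - lam) • φm j) ''
            (if j = p then Set.Icc (0 : ℝ) 1 else Set.Ioc (0 : ℝ) 1) := by
  have mono {i j : ℕ} (hij : i ≤ j) (hj : j ≤ p) : w i ≤ w j := le_of_step_lt hw hij hj
  have affine (n : ℕ) (hn : n < p) (t : ℝ) (ht0 : 0 ≤ t) (ht1 : t ≤ 1)
      (ht : n + 1 ≠ p → 0 < t) :
      t • φ n + (1 - t) • φm (n + 1) = G (t * w n + (1 - t) * w (n + 1)) := by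
    have hlt := hw n hn
    have hl : w n ≤ t * w n + (1 - t) * w (n + 1) := by nlinarith
    have hr : t * w n + (1 - t) * w (n + 1) ≤ w (n + 1) := by nlinarith
    have hr' : n + 1 ≠ p → t * w n + (1 - t) * w (n + 1) < w (n + 1) := fun h => by
      nlinarith [ht h]
    generalize hx : t * w n + (1 - t) * w (n + 1) = x at hl hr hr' ⊢
    rw [hφ, hφm, hG, hG]
    refine Prod.ext (funext fun k => ?_) (funext fun k => ?_)
    · obtain ⟨k, hk⟩ := k
      simp only [Prod.fst_add, Prod.smul_fst, Pi.add_apply, Pi.smul_apply, smul_eq_mul]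
      rcases k with _ | k
      · simp only [zero_add, hV1]
        rcases n with _ | n
        · rw [min_eq_left hlt.le, min_self, min_eq_left hr, hx]
        · have h1 : w 1 ≤ w (n + 1) := mono (by omega) (by omega)
          rw [min_eq_right h1, min_eq_right (h1.trans hlt.le), min_eq_right (h1.trans hl)]
          ring
      · simp only [hVj (k + 1 + 1) (by omega), Nat.add_sub_cancel]
        rcases lt_trichotomy (k + 1) n with h | rfl | h
        · have h1 : w (k + 1 + 1) ≤ w n := mono h hn.le
          rw [min_eq_right h1, min_eq_right (h1.trans hlt.le), min_eq_right (h1.trans hl)]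
          ring
        · rw [min_eq_left hlt.le, min_self, min_eq_left hr, sub_self, max_self,
            max_eq_left (by linarith), max_eq_left (by linarith)]
          linarith
        · have h1 : w (n + 1) ≤ w (k + 1) := mono h hk.le
          have hz {y : ℝ} (hy : y ≤ w (n + 1)) :
              max (min y (w (k + 1 + 1)) - w (k + 1)) 0 = 0 :=
            max_eq_right (by linarith [min_le_left y (w (k + 1 + 1))])
          rw [hz hlt.le, hz le_rfl, hz hr]
          ring
    · obtain ⟨k, hk⟩ := k
      simp only [Prod.snd_add, Prod.smul_snd, Pi.add_apply, Pi.smul_apply, smul_eq_mul, hQ]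
      rcases lt_or_ge k n with h | h
      · have h1 : w (k + 1) ≤ w n := mono h hn.le
        rw [if_pos h1, if_pos (by omega), if_pos (h1.trans hl)]
        ring
      · have h1 : w (n + 1) ≤ w (k + 1) := mono (by omega) (by omega)
        have h2 : x < w (n + 1) := hr' (by omega)
        rw [if_neg (by linarith), if_neg (by omega), if_neg (by linarith)]
        ring
  ext y
  simp only [Set.mem_image, Set.mem_iUnion, Finset.mem_Icc, exists_prop]
  constructor
  · rintro ⟨x, ⟨h0, hx⟩, rfl⟩
    obtain ⟨n, hn, h1, h2, h3⟩ := exists_cell hp w h0 hx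
    have hd : 0 < w (n + 1) - w n := sub_pos.2 (hw n hn)
    have ht0 : 0 ≤ (w (n + 1) - x) / (w (n + 1) - w n) := div_nonneg (by linarith) hd.le
    have ht1 : (w (n + 1) - x) / (w (n + 1) - w n) ≤ 1 := (div_le_one hd).2 (by linarith)
    have ht (h : n + 1 ≠ p) : 0 < (w (n + 1) - x) / (w (n + 1) - w n) :=
      div_pos (by linarith [h3 h]) hd
    refine ⟨n + 1, ⟨by omega, hn⟩, (w (n + 1) - x) / (w (n + 1) - w n), ?_, ?_⟩
    · split_ifs with h
      · exact ⟨ht0, ht1⟩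
      · exact ⟨ht h, ht1⟩
    · rw [Nat.add_sub_cancel, affine n hn _ ht0 ht1 ht]
      congr 1
      field_simp
      ring
  · rintro ⟨j, ⟨hj1, hjp⟩, t, ht, rfl⟩
    obtain ⟨n, rfl⟩ := Nat.exists_eq_add_of_le' hj1
    have htc : 0 ≤ t ∧ t ≤ 1 ∧ (n + 1 ≠ p → 0 < t) := by
      split_ifs at ht with h
      · exact ⟨ht.1, ht.2, fun h' => absurd h h'⟩
      · exact ⟨ht.1.le, ht.2, fun _ => ht.1⟩
    obtain ⟨ht0, ht1, hpos⟩ := htc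
    refine ⟨t * w n + (1 - t) * w (n + 1), ⟨?_, ?_⟩, (affine n hjp t ht0 ht1 hpos).symm⟩
    · have := mono (Nat.zero_le n) (by omega)
      nlinarith [hw n hjp]
    · have := mono hjp le_rfl
      nlinarith [hw n hjp]
end

section
/- Let a, b ∈ ℝ^d, g, r ∈ ℝ^d, s ∈ ℝ and λ ≥ 0, and let S = {θ·a + (1−θ)·b : θ ∈ (0,1]} be the half-open segment from b (excluded) to a (included). Then the supremum of the penalized linear function over S both admits a minimax exchange and is determined by the two endpoints: sup_{x ∈ S} [ g·x − λ|r·x − s| ] = sup_{x ∈ S} min_{ζ ∈ [−λ,λ]} [ g·x − ζ(r·x − s) ] = min_{ζ ∈ [−λ,λ]} sup_{x ∈ S} [ g·x − ζ(r·x − s) ] = min_{ζ ∈ [−λ,λ]} max{ g·a − ζ(r·a − s), g·b − ζ(r·b − s) }. -/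
open Set in
theorem isLeast_image_sub_mul_Icc (c t : ℝ) {lam : ℝ} (hlam : 0 ≤ lam) :
    IsLeast ((fun ζ => c - ζ * t) '' Icc (-lam) lam) (c - lam * |t|) := by
  constructor
  · rcases abs_cases t with ⟨h, -⟩ | ⟨h, -⟩
    · exact ⟨lam, ⟨by linarith, le_rfl⟩, by simp only [h]⟩
    · exact ⟨-lam, ⟨le_rfl, by linarith⟩, by simp only [h]; ring⟩
  · rintro _ ⟨ζ, hζ, rfl⟩
    have h1 : ζ * t ≤ |ζ| * |t| := (le_abs_self _).trans (abs_mul ζ t).le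
    have h2 : |ζ| * |t| ≤ lam * |t| :=
      mul_le_mul_of_nonneg_right (abs_le.2 hζ) (abs_nonneg t)
    simp only
    linarith

open Set in
theorem le_of_forall_mem_Ioc_le {f : ℝ → ℝ} (hf : Continuous f) {M : ℝ}
    (h : ∀ θ ∈ Ioc (0 : ℝ) 1, f θ ≤ M) {θ : ℝ} (hθ : θ ∈ Icc (0 : ℝ) 1) : f θ ≤ M := by
  rw [← closure_Ioc zero_ne_one] at hθ
  exact closure_minimal (t := {θ | f θ ≤ M}) h (isClosed_le hf continuous_const) hθ

theorem mul_add_one_sub_mul_le_max {θ : ℝ} (h0 : 0 ≤ θ) (h1 : θ ≤ 1) (A B : ℝ) :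
    θ * A + (1 - θ) * B ≤ max A B := by
  nlinarith [mul_le_mul_of_nonneg_left (le_max_left A B) h0,
    mul_le_mul_of_nonneg_left (le_max_right A B) (sub_nonneg.2 h1)]

open Set in
theorem isLUB_image_Ioc_max (A B : ℝ) :
    IsLUB ((fun θ : ℝ => θ * A + (1 - θ) * B) '' Ioc 0 1) (max A B) := by
  constructor
  · rintro _ ⟨θ, hθ, rfl⟩
    exact mul_add_one_sub_mul_le_max hθ.1.le hθ.2 A B
  · intro M hM
    have h : ∀ θ ∈ Icc (0 : ℝ) 1, θ * A + (1 - θ) * B ≤ M := fun θ hθ =>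
      le_of_forall_mem_Ioc_le (f := fun θ => θ * A + (1 - θ) * B) (by fun_prop)
        (fun θ hθ => hM (mem_image_of_mem _ hθ)) hθ
    exact max_le (by simpa using h 1 (by simp)) (by simpa using h 0 (by simp))

open Set in
/-- Saddle points of the bilinear function behind the penalized linear function
on a segment. -/
theorem exists_saddle_segment (p q u v : ℝ) {lam : ℝ} (hlam : 0 ≤ lam) :
    ∃ ζ₀ ∈ Icc (-lam) lam, ∃ θ₀ ∈ Icc (0 : ℝ) 1, ∀ ζ ∈ Icc (-lam) lam, ∀ θ ∈ Icc (0 : ℝ) 1,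
      θ * (p - ζ₀ * u) + (1 - θ) * (q - ζ₀ * v)
        ≤ θ₀ * (p - ζ * u) + (1 - θ₀) * (q - ζ * v) := by
  refine Sion.exists_isSaddlePointOn (X := Icc (-lam) lam) (Y := Icc (0 : ℝ) 1)
    (f := fun ζ θ => θ * (p - ζ * u) + (1 - θ) * (q - ζ * v))
    ⟨0, by simpa using hlam⟩ (convex_Icc _ _) isCompact_Icc ?_ ?_
    (convex_Icc _ _) ⟨0, by simp⟩ isCompact_Icc ?_ ?_
  · intro θ _
    exact (Continuous.continuousOn (by fun_prop)).lowerSemicontinuousOn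
  · intro θ _
    refine ConvexOn.quasiconvexOn ⟨convex_Icc _ _, fun x _ y _ a b _ _ hab => le_of_eq ?_⟩
    obtain rfl := eq_sub_of_add_eq hab
    simp only [smul_eq_mul]
    ring
  · intro ζ _
    exact (Continuous.continuousOn (by fun_prop)).upperSemicontinuousOn
  · intro ζ _
    refine ConcaveOn.quasiconcaveOn ⟨convex_Icc _ _, fun x _ y _ a b _ _ hab => le_of_eq ?_⟩
    obtain rfl := eq_sub_of_add_eq hab
    simp only [smul_eq_mul]
    ring

open Set in
theorem isLeast_max_sSup_segment (p q u v : ℝ) {lam : ℝ} (hlam : 0 ≤ lam) :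
    IsLeast ((fun ζ => max (p - ζ * u) (q - ζ * v)) '' Icc (-lam) lam)
      (sSup ((fun θ : ℝ => θ * p + (1 - θ) * q - lam * |θ * u + (1 - θ) * v|) '' Ioc 0 1)) := by
  set F : ℝ → ℝ := fun θ => θ * p + (1 - θ) * q - lam * |θ * u + (1 - θ) * v| with hF
  have hle : ∀ θ ∈ Ioc (0 : ℝ) 1, ∀ ζ ∈ Icc (-lam) lam,
      F θ ≤ max (p - ζ * u) (q - ζ * v) := by
    intro θ hθ ζ hζ
    have h1 := (isLeast_image_sub_mul_Icc (θ * p + (1 - θ) * q) (θ * u + (1 - θ) * v) hlam).2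
      (mem_image_of_mem _ hζ)
    have h2 := mul_add_one_sub_mul_le_max hθ.1.le hθ.2 (p - ζ * u) (q - ζ * v)
    simp only [hF] at h1 ⊢
    linarith
  have hne : (F '' Ioc 0 1).Nonempty := ⟨_, mem_image_of_mem F (show (1 : ℝ) ∈ Ioc 0 1 by simp)⟩
  have hlow : ∀ ζ ∈ Icc (-lam) lam, sSup (F '' Ioc 0 1) ≤ max (p - ζ * u) (q - ζ * v) :=
    fun ζ hζ => csSup_le hne (forall_mem_image.2 fun θ hθ => hle θ hθ ζ hζ)
  have h0 : (0 : ℝ) ∈ Icc (-lam) lam := by simpa using hlam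
  have hbdd : BddAbove (F '' Ioc 0 1) := ⟨_, forall_mem_image.2 fun θ hθ => hle θ hθ 0 h0⟩
  refine ⟨?_, forall_mem_image.2 hlow⟩
  obtain ⟨ζ₀, hζ₀, θ₀, hθ₀, hs⟩ := exists_saddle_segment p q u v hlam
  refine ⟨ζ₀, hζ₀, le_antisymm ?_ (hlow ζ₀ hζ₀)⟩
  have hFθ₀ : F θ₀ ≤ sSup (F '' Ioc 0 1) :=
    le_of_forall_mem_Ioc_le (by fun_prop) (fun θ hθ => le_csSup hbdd (mem_image_of_mem F hθ)) hθ₀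
  obtain ⟨ζ, hζ, hζF⟩ :=
    (isLeast_image_sub_mul_Icc (θ₀ * p + (1 - θ₀) * q) (θ₀ * u + (1 - θ₀) * v) hlam).1
  have hsup : θ₀ * (p - ζ * u) + (1 - θ₀) * (q - ζ * v) ≤ sSup (F '' Ioc 0 1) := by
    simp only [hF] at hζF hFθ₀ ⊢
    linarith
  refine max_le ?_ ?_
  · have := hs ζ hζ 1 (by simp)
    linarith
  · have := hs ζ hζ 0 (by simp)
    linarith


/-- On the half-open segment `S = {θ•a + (1−θ)•b : θ ∈ (0,1]}`, the
supremum of the penalized linear function `x ↦ g·x − λ|r·x − s|` admits a minimax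
exchange and is determined by the two endpoint values. -/
theorem stmt_4 (d : ℕ) (a b g r : Fin d → ℝ) (s lam : ℝ) (hlam : 0 ≤ lam)
    (S : Set (Fin d → ℝ))
    (hS : S = (fun θ : ℝ => θ • a + (1 - θ) • b) '' Set.Ioc (0 : ℝ) 1)
    (dot : (Fin d → ℝ) → (Fin d → ℝ) → ℝ)
    (hdot : ∀ x y, dot x y = ∑ i, x i * y i)
    (h : ℝ → (Fin d → ℝ) → ℝ)
    (hh : ∀ ζ x, h ζ x = dot g x - ζ * (dot r x - s)) :
    sSup ((fun x => dot g x - lam * |dot r x - s|) '' S)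
      = sSup ((fun x => sInf ((fun ζ => h ζ x) '' Set.Icc (-lam) lam)) '' S)
    ∧ sSup ((fun x => dot g x - lam * |dot r x - s|) '' S)
      = sInf ((fun ζ => sSup (h ζ '' S)) '' Set.Icc (-lam) lam)
    ∧ sSup ((fun x => dot g x - lam * |dot r x - s|) '' S)
      = sInf ((fun ζ => max (h ζ a) (h ζ b)) '' Set.Icc (-lam) lam) := by
  have hdot_segment : ∀ (w : Fin d → ℝ) (θ : ℝ),
      dot w (θ • a + (1 - θ) • b) = θ * dot w a + (1 - θ) * dot w b := by
    intro w θ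
    simp only [hdot, Finset.mul_sum, ← Finset.sum_add_distrib, Pi.add_apply, Pi.smul_apply,
      smul_eq_mul]
    exact Finset.sum_congr rfl fun i _ => by ring
  have hinf : ∀ x, sInf ((fun ζ => h ζ x) '' Set.Icc (-lam) lam)
      = dot g x - lam * |dot r x - s| := by
    intro x
    simp only [hh]
    exact (isLeast_image_sub_mul_Icc _ _ hlam).csInf_eq
  have hsup : ∀ ζ, sSup (h ζ '' S) = max (h ζ a) (h ζ b) := by
    intro ζ
    rw [hS, Set.image_image, ← (isLUB_image_Ioc_max (h ζ a) (h ζ b)).csSup_eq (by simp)]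
    congr 2
    funext θ
    simp only [hh, hdot_segment]
    ring
  have hmain : sSup ((fun x => dot g x - lam * |dot r x - s|) '' S)
      = sInf ((fun ζ => max (h ζ a) (h ζ b)) '' Set.Icc (-lam) lam) := by
    simp only [hh]
    rw [(isLeast_max_sSup_segment (dot g a) (dot g b) (dot r a - s) (dot r b - s)
      hlam).csInf_eq, hS, Set.image_image]
    congr 2
    funext θ
    rw [hdot_segment, hdot_segment]
    congr 3
    ring
  simp only [hinf, hsup]
  exact ⟨trivial, hmain, hmain⟩
end

section
/- For any g ∈ ℝ^p × ℝ^{p−1}, any λ ≥ 0 and any ξ̂ ∈ ℝ: sup_{ξ ∈ [l,v]} [ g·G(ξ) − λ|ξ − ξ̂| ] = max_{j=1,…,p} min_{ζ ∈ [−λ,λ]} max{ g·φ⁻_j − ζ·(w_j − ξ̂), g·φ_{j−1} − ζ·(w_{j−1} − ξ̂) }. -/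
/-- Concave maximization of `x ↦ A + s (x - a) - lam |x - ξ|` on `[a, b]`: a primal-dual pair with
no duality gap. -/
theorem exists_primal_dual_pair {a b lam : ℝ} (hab : a < b) (hlam : 0 ≤ lam) (A s ξ : ℝ) :
    ∃ x ∈ Set.Icc a b, ∃ ζ ∈ Set.Icc (-lam) lam,
      max (A + s * (b - a) - ζ * (b - ξ)) (A - ζ * (a - ξ)) ≤ A + s * (x - a) - lam * |x - ξ| := by
  rcases lt_or_ge lam s with h1 | h1
  · rcases le_total ξ b with h | h
    · refine ⟨b, ⟨hab.le, le_rfl⟩, lam, ⟨by linarith, le_rfl⟩, ?_⟩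
      rw [abs_of_nonneg (by linarith)]
      refine max_le ?_ ?_ <;> nlinarith
    · refine ⟨b, ⟨hab.le, le_rfl⟩, -lam, ⟨le_rfl, by linarith⟩, ?_⟩
      rw [abs_of_nonpos (by linarith)]
      refine max_le ?_ ?_ <;> nlinarith
  rcases lt_or_ge s (-lam) with h2 | h2
  · rcases le_total ξ a with h | h
    · refine ⟨a, ⟨le_rfl, hab.le⟩, lam, ⟨by linarith, le_rfl⟩, ?_⟩
      rw [abs_of_nonneg (by linarith)]
      refine max_le ?_ ?_ <;> nlinarith
    · refine ⟨a, ⟨le_rfl, hab.le⟩, -lam, ⟨le_rfl, by linarith⟩, ?_⟩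
      rw [abs_of_nonpos (by linarith)]
      refine max_le ?_ ?_ <;> nlinarith
  rcases lt_or_ge ξ a with h | h
  · refine ⟨a, ⟨le_rfl, hab.le⟩, lam, ⟨by linarith, le_rfl⟩, ?_⟩
    rw [abs_of_nonneg (by linarith)]
    refine max_le ?_ ?_ <;> nlinarith
  rcases lt_or_ge b ξ with h' | h'
  · refine ⟨b, ⟨hab.le, le_rfl⟩, -lam, ⟨le_rfl, by linarith⟩, ?_⟩
    rw [abs_of_nonpos (by linarith)]
    refine max_le ?_ ?_ <;> nlinarith
  · refine ⟨ξ, ⟨h, h'⟩, s, ⟨h2, h1⟩, ?_⟩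
    rw [sub_self, abs_zero]
    refine max_le ?_ ?_ <;> nlinarith

/-- Weak duality for `x ↦ A + s (x - a) - lam |x - ξ|` on `[a, b]`. -/
theorem affine_sub_abs_le_max {a b x lam ζ : ℝ} (hx : x ∈ Set.Icc a b)
    (hζ : ζ ∈ Set.Icc (-lam) lam) (A s ξ : ℝ) :
    A + s * (x - a) - lam * |x - ξ| ≤
      max (A + s * (b - a) - ζ * (b - ξ)) (A - ζ * (a - ξ)) := by
  have h : ζ * (x - ξ) ≤ lam * |x - ξ| :=
    (le_abs_self _).trans (by
      rw [abs_mul]; exact mul_le_mul_of_nonneg_right (abs_le.2 hζ) (abs_nonneg _))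
  rcases le_total ζ s with hs | hs
  · exact le_max_of_le_left (by nlinarith [hx.2])
  · exact le_max_of_le_right (by nlinarith [hx.1])

/-- On `[w i, w (i + 1)]` only the coordinate `i + 1` of the continuous part of the lifting
varies, and it does so with slope one. -/
theorem lifting_continuous_part {p : ℕ} {w : ℕ → ℝ} (hmono : MonotoneOn w (Set.Iic p))
    {V : ℕ → ℝ → ℝ} (hV1 : ∀ x : ℝ, V 1 x = min x (w 1))
    (hVj : ∀ j, 2 ≤ j → ∀ x : ℝ, V j x = max (min x (w j) - w (j - 1)) 0)
    (gV : ℕ → ℝ) {i : ℕ} (hi : i < p) {x : ℝ} (hx : x ∈ Set.Icc (w i) (w (i + 1))) :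
    ∑ k ∈ Finset.Icc 1 p, gV k * V k x =
      ∑ k ∈ Finset.Icc 1 p, gV k * V k (w i) + gV (i + 1) * (x - w i) := by
  have hV : ∀ k ∈ Finset.Icc 1 p,
      gV k * V k x = gV k * V k (w i) + if i + 1 = k then gV k * (x - w i) else 0 := by
    intro k hk
    obtain ⟨hk1, hkp⟩ := Finset.mem_Icc.1 hk
    have hle : ∀ a b, a ≤ b → b ≤ p → w a ≤ w b := fun a b hab hb =>
      hmono (hab.trans hb) hb hab
    obtain ⟨hx1, hx2⟩ := hx
    suffices h : V k x = V k (w i) + if i + 1 = k then x - w i else 0 by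
      rw [h]; split_ifs <;> ring
    have h0 := hle (k - 1) k (by omega) hkp
    rcases lt_trichotomy (i + 1) k with h | h | h
    · have h3 := hle (i + 1) (k - 1) (by omega) (by omega)
      rw [hVj k (by omega), hVj k (by omega), if_neg h.ne, min_eq_left (by linarith),
        min_eq_left (by linarith), max_eq_right (by linarith), max_eq_right (by linarith)]
      simp
    · subst h
      rw [if_pos rfl]
      rcases Nat.eq_zero_or_pos i with rfl | h1
      · rw [hV1, hV1, min_eq_left hx2, min_eq_left (by linarith)]
        ring
      · rw [hVj _ (by omega), hVj _ (by omega), min_eq_left hx2, min_eq_left (by linarith)]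
        simp [hx1]
    · have h3 := hle k i (by omega) hi.le
      rw [if_neg h.ne', add_zero]
      rcases Nat.lt_or_ge k 2 with h1 | h1
      · obtain rfl : k = 1 := by omega
        rw [hV1, hV1, min_eq_right (by linarith), min_eq_right h3]
      · rw [hVj k h1, hVj k h1, min_eq_right (by linarith), min_eq_right h3]
  rw [Finset.sum_congr rfl hV, Finset.sum_add_distrib, Finset.sum_ite_eq,
    if_pos (Finset.mem_Icc.2 ⟨by omega, by omega⟩)]

/-- The pieces `[w i, w (i + 1))` together with the right endpoint cover `[w 0, w p]`. -/
theorem exists_piece {p : ℕ} (hp : 1 ≤ p) (w : ℕ → ℝ) {x : ℝ} (hx : x ∈ Set.Icc (w 0) (w p)) :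
    ∃ i < p, x ∈ Set.Icc (w i) (w (i + 1)) ∧ (x < w (i + 1) ∨ i + 1 = p) := by
  induction p, hp using Nat.le_induction with
  | base => exact ⟨0, one_pos, hx, Or.inr rfl⟩
  | succ n hn ih =>
    rcases le_or_gt (w n) x with h | h
    · exact ⟨n, n.lt_succ_self, ⟨h, hx.2⟩, Or.inr rfl⟩
    · obtain ⟨i, hi, hxi, hlt⟩ := ih ⟨hx.1, h.le⟩
      refine ⟨i, by omega, hxi, Or.inl ?_⟩
      rcases hlt with hlt | rfl
      · exact hlt
      · exact h


/-- The supremum of `g·G(ξ) − λ|ξ − ξ̂|` over `[l, v]` equals the maximum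
over the pieces `j = 1,…,p` of the minimum over `ζ ∈ [−λ, λ]` of the maximum of the two
endpoint values `g·φ⁻ⱼ − ζ(wⱼ − ξ̂)` and `g·φ_{j−1} − ζ(w_{j−1} − ξ̂)`.  The vector `g` is
written through its coefficients `gV j` (continuous components) and `gQ j` (binary
components); `dG` is `ξ ↦ g·G(ξ)`, `dφ j = g·φⱼ`, and `dφm j = g·φ⁻ⱼ`. -/
theorem stmt_5 (p : ℕ) (hp : 1 ≤ p) (w : ℕ → ℝ)
    (hw : ∀ j < p, w j < w (j + 1))
    (V : ℕ → ℝ → ℝ)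
    (hV1 : ∀ x : ℝ, V 1 x = min x (w 1))
    (hVj : ∀ j, 2 ≤ j → ∀ x : ℝ, V j x = max (min x (w j) - w (j - 1)) 0)
    (Q : ℕ → ℝ → ℝ)
    (hQ : ∀ j, ∀ x : ℝ, Q j x = if w j ≤ x then 1 else 0)
    (gV gQ : ℕ → ℝ) (lam : ℝ) (hlam : 0 ≤ lam) (ξhat : ℝ)
    (dG : ℝ → ℝ)
    (hdG : ∀ x : ℝ, dG x = (∑ j ∈ Finset.Icc 1 p, gV j * V j x)
        + ∑ j ∈ Finset.Icc 1 (p - 1), gQ j * Q j x)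
    (dφ : ℕ → ℝ) (hdφ : ∀ j, dφ j = dG (w j))
    (dφm : ℕ → ℝ)
    (hdφm : ∀ j, dφm j = (∑ k ∈ Finset.Icc 1 p, gV k * V k (w j))
        + ∑ k ∈ Finset.Icc 1 (p - 1), gQ k * (if k < j then 1 else 0)) :
    sSup ((fun x => dG x - lam * |x - ξhat|) '' Set.Icc (w 0) (w p))
      = (Finset.Icc 1 p).sup' (Finset.nonempty_Icc.mpr hp)
          (fun j => sInf ((fun ζ => max (dφm j - ζ * (w j - ξhat))
              (dφ (j - 1) - ζ * (w (j - 1) - ξhat))) '' Set.Icc (-lam) lam)) := by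
  have hmono' : StrictMonoOn w (Set.Iic p) :=
    strictMonoOn_of_lt_add_one Set.ordConnected_Iic fun a _ _ ha => hw a ha
  have hmono := hmono'.monotoneOn
  have hpiece : ∀ i < p, ∀ x ∈ Set.Icc (w i) (w (i + 1)), (x < w (i + 1) ∨ i + 1 = p) →
      dG x = dφ i + gV (i + 1) * (x - w i) := by
    intro i hi x hx hlt
    rw [hdφ, hdG, hdG, lifting_continuous_part hmono hV1 hVj gV hi hx, add_right_comm]
    congr 2
    refine Finset.sum_congr rfl fun k hk => ?_
    obtain ⟨hk1, hkp⟩ := Finset.mem_Icc.1 hk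
    rw [hQ, hQ]
    congr 1
    rcases Nat.lt_or_ge i k with h | h
    · have h1 : w i < w k := hmono' hi.le (show k ≤ p by omega) h
      have h2 : w (i + 1) ≤ w k := hmono hi (show k ≤ p by omega) h
      have h3 : x < w (i + 1) := hlt.resolve_right (by omega)
      rw [if_neg (by linarith), if_neg (by linarith)]
    · have h1 : w k ≤ w i := hmono (h.trans hi.le) hi.le h
      rw [if_pos (by linarith [hx.1]), if_pos h1]
  have hright : ∀ i < p, dφm (i + 1) = dφ i + gV (i + 1) * (w (i + 1) - w i) := by
    intro i hi
    rw [hdφ, hdφm, hdG, lifting_continuous_part hmono hV1 hVj gV hi ⟨(hw i hi).le, le_rfl⟩,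
      add_right_comm]
    congr 2
    refine Finset.sum_congr rfl fun k hk => ?_
    obtain ⟨hk1, hkp⟩ := Finset.mem_Icc.1 hk
    simp only [hQ, hmono'.le_iff_le (show k ≤ p by omega) hi.le, Nat.lt_succ_iff]
  let M := (Finset.Icc 1 p).sup' (Finset.nonempty_Icc.mpr hp)
    (fun j => sInf ((fun ζ => max (dφm j - ζ * (w j - ξhat))
      (dφ (j - 1) - ζ * (w (j - 1) - ξhat))) '' Set.Icc (-lam) lam))
  have hupper : ∀ y ∈ (fun x => dG x - lam * |x - ξhat|) '' Set.Icc (w 0) (w p), y ≤ M := by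
    rintro _ ⟨x, hx, rfl⟩
    obtain ⟨i, hi, hxi, hlt⟩ := exists_piece hp w hx
    refine le_trans ?_ (Finset.le_sup' _ (Finset.mem_Icc.2 ⟨i.succ_pos, hi⟩))
    refine le_csInf (Set.Nonempty.image _ ⟨lam, by linarith, le_rfl⟩) ?_
    rintro _ ⟨ζ, hζ, rfl⟩
    simp only [Nat.succ_eq_add_one, Nat.add_sub_cancel]
    rw [hpiece i hi x hxi hlt, hright i hi]
    exact affine_sub_abs_le_max hxi hζ _ _ _
  have hle : w 0 ≤ w p := hmono (Nat.zero_le p) Set.self_mem_Iic (Nat.zero_le p)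
  refine le_antisymm (csSup_le (Set.Nonempty.image _ ⟨w 0, le_rfl, hle⟩) hupper)
    (Finset.sup'_le _ _ fun j hj => ?_)
  obtain ⟨hj1, hjp⟩ := Finset.mem_Icc.1 hj
  obtain ⟨i, rfl⟩ := Nat.exists_eq_add_of_le' hj1
  have hi : i < p := hjp
  have hlt := hw i hi
  obtain ⟨x, hx, ζ, hζ, hxζ⟩ := exists_primal_dual_pair hlt hlam (dφ i) (gV (i + 1)) ξhat
  have hbdd : BddBelow ((fun ζ => max (dφm (i + 1) - ζ * (w (i + 1) - ξhat))
      (dφ i - ζ * (w i - ξhat))) '' Set.Icc (-lam) lam) := by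
    refine ⟨dφ i + gV (i + 1) * (x - w i) - lam * |x - ξhat|, ?_⟩
    rintro _ ⟨ζ', hζ', rfl⟩
    simp only [hright i hi]
    exact affine_sub_abs_le_max hx hζ' _ _ _
  refine (csInf_le hbdd ⟨ζ, hζ, rfl⟩).trans ?_
  simp only [hright i hi]
  refine hxζ.trans ?_
  have hclosed : IsClosed {y | dφ i + gV (i + 1) * (y - w i) - lam * |y - ξhat| ≤
      sSup ((fun x => dG x - lam * |x - ξhat|) '' Set.Icc (w 0) (w p))} :=
    isClosed_le (by fun_prop) continuous_const
  rw [← closure_Ico hlt.ne] at hx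
  refine hclosed.closure_subset_iff.2 (fun y hy => ?_) hx
  refine le_csSup ⟨M, hupper⟩ ⟨y, ⟨?_, ?_⟩, ?_⟩
  · exact (hmono (Nat.zero_le p) hi.le (Nat.zero_le i)).trans hy.1
  · exact hy.2.le.trans (hmono hi Set.self_mem_Iic hi)
  · simp only [hpiece i hi y ⟨hy.1, hy.2.le⟩ (Or.inl hy.2)]
end

section
/- (Lemma 1.) Let M ≥ 1, let g_{m,i} ∈ ℝ^{p_i} × ℝ^{p_i−1} and h_m ∈ ℝ for m = 1,…,M and i = 1,…,n, let λ ≥ 0, ξ̂ ∈ ℝ^n, η ∈ ℝ, and define f(ξ) = max_{m=1,…,M} [ Σ_{i=1}^n g_{m,i}·G_i(ξ_i) + h_m ] for ξ ∈ Ξ. Then η ≥ sup_{ξ ∈ Ξ} [ f(ξ) − λ‖ξ − ξ̂‖₁ ] holds if and only if there exist reals η_{m,i} (m ∈ [M], i ∈ [n]) and ζ_{m,i,j} ∈ [−λ, λ] (m ∈ [M], i ∈ [n], j ∈ [p_i]) such that: for every m, η ≥ Σ_{i=1}^n η_{m,i} + h_m; and for every m, i, j, both η_{m,i} ≥ g_{m,i}·φ⁻_{i,j}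 − ζ_{m,i,j}·(w_{i,j} − ξ̂_i) and η_{m,i} ≥ g_{m,i}·φ_{i,j−1} − ζ_{m,i,j}·(w_{i,j−1} − ξ̂_i). -/
/-- A bound on a separable sum over a product of nonempty sets splits into bounds on the
individual summands. -/
theorem exists_separate_bounds {ι : Type*} [Fintype ι] {α : ι → Type*} (S : ∀ i, Set (α i))
    (hS : ∀ i, (S i).Nonempty) (F : ∀ i, α i → ℝ) (c : ℝ)
    (h : ∀ x ∈ Set.univ.pi S, ∑ i, F i (x i) ≤ c) :
    ∃ e : ι → ℝ, ∑ i, e i ≤ c ∧ ∀ i, ∀ x ∈ S i, F i x ≤ e i := by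
  classical
  choose x₀ hx₀ using hS
  have hbdd : ∀ i, BddAbove (F i '' S i) := by
    intro i
    refine ⟨c - ∑ k ∈ Finset.univ.erase i, F k (x₀ k), ?_⟩
    rintro _ ⟨x, hx, rfl⟩
    have hmem : Function.update x₀ i x ∈ Set.univ.pi S := by
      intro k _
      rcases eq_or_ne k i with rfl | hk
      · simpa using hx
      · simpa [hk] using hx₀ k
    have hsum := h _ hmem
    rw [← Finset.add_sum_erase _ _ (Finset.mem_univ i)] at hsum
    have hrest : ∑ k ∈ Finset.univ.erase i, F k (Function.update x₀ i x k)
        = ∑ k ∈ Finset.univ.erase i, F k (x₀ k) :=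
      Finset.sum_congr rfl fun k hk => by
        rw [Function.update_of_ne (Finset.ne_of_mem_erase hk)]
    rw [hrest, Function.update_self] at hsum
    linarith
  refine ⟨fun i => sSup (F i '' S i), ?_, fun i x hx => le_csSup (hbdd i) ⟨x, hx, rfl⟩⟩
  refine le_of_forall_pos_le_add fun ε hε => ?_
  have hcard : (0 : ℝ) < Fintype.card ι + 1 := by positivity
  have happrox : ∀ i, ∃ x ∈ S i, sSup (F i '' S i) - ε / (Fintype.card ι + 1) < F i x := by
    intro i
    obtain ⟨_, ⟨x, hx, rfl⟩, hlt⟩ := exists_lt_of_lt_csSup (s := F i '' S i)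
      ⟨_, x₀ i, hx₀ i, rfl⟩ (sub_lt_self _ (div_pos hε hcard))
    exact ⟨x, hx, hlt⟩
  choose x hx hlt using happrox
  have hsum := h x fun i _ => hx i
  have hle := Finset.sum_le_sum fun i (_ : i ∈ Finset.univ) => (hlt i).le
  rw [Finset.sum_sub_distrib, Finset.sum_const, Finset.card_univ, nsmul_eq_mul] at hle
  have hfrac : Fintype.card ι * (ε / (Fintype.card ι + 1)) ≤ ε := by
    rw [← mul_div_assoc, div_le_iff₀ hcard]
    nlinarith
  linarith

/-- If an affine function penalized by `lam * |x - y|` is bounded on `[u, v)`, then some linear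
penalty with slope in `[-lam, lam]` gives the same bound at both endpoints. -/
theorem exists_slope_of_affine_sub_abs_le {u v y lam c s e : ℝ} (huv : u < v) (hlam : 0 ≤ lam)
    (h : ∀ x ∈ Set.Ico u v, c + s * x - lam * |x - y| ≤ e) :
    ∃ ζ : ℝ, |ζ| ≤ lam ∧ c + s * v - ζ * (v - y) ≤ e ∧ c + s * u - ζ * (u - y) ≤ e := by
  have hIcc : ∀ x ∈ Set.Icc u v, c + s * x - lam * |x - y| ≤ e := by
    have hclosed : IsClosed {x : ℝ | c + s * x - lam * |x - y| ≤ e} :=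
      isClosed_le (by fun_prop) continuous_const
    rw [← closure_Ico huv.ne]
    exact closure_minimal h hclosed
  have hu := hIcc u ⟨le_rfl, huv.le⟩
  have hv := hIcc v ⟨huv.le, le_rfl⟩
  rcases le_or_gt y u with hyu | hyu
  · refine ⟨lam, (abs_of_nonneg hlam).le, ?_, ?_⟩
    · rwa [abs_of_nonneg (by linarith)] at hv
    · rwa [abs_of_nonneg (by linarith)] at hu
  rcases le_or_gt v y with hvy | hvy
  · refine ⟨-lam, by rw [abs_neg, abs_of_nonneg hlam], ?_, ?_⟩
    · rw [abs_of_nonpos (by linarith)] at hv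
      linarith
    · rw [abs_of_nonpos (by linarith)] at hu
      linarith
  have hy := hIcc y ⟨hyu.le, hvy.le⟩
  rw [sub_self, abs_zero, mul_zero, sub_zero] at hy
  rw [abs_of_nonneg (by linarith)] at hv
  rw [abs_of_nonpos (by linarith)] at hu
  have hvy' : 0 < v - y := by linarith
  have hyu' : 0 < y - u := by linarith
  refine ⟨max (-lam) ((c + s * v - e) / (v - y)), ?_, ?_, ?_⟩
  · rw [abs_le]
    refine ⟨le_max_left _ _, max_le (by linarith) ?_⟩
    rw [div_le_iff₀ hvy']
    linarith
  · have := le_max_right (-lam) ((c + s * v - e) / (v - y))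
    rw [div_le_iff₀ hvy'] at this
    linarith
  · have : max (-lam) ((c + s * v - e) / (v - y)) ≤ (e - c - s * u) / (y - u) := by
      refine max_le ?_ ?_
      · rw [le_div_iff₀ hyu']
        linarith
      · rw [div_le_div_iff₀ hvy' hyu']
        nlinarith
    rw [le_div_iff₀ hyu'] at this
    linarith

/-- If an affine function with a linear penalty of slope in `[-lam, lam]` is bounded at the
endpoints of `[u, v]`, then the same bound holds on `[u, v]` with the penalty `lam * |x - y|`. -/
theorem affine_sub_abs_le_of_slope {u v y lam c s e ζ x : ℝ} (hζ : |ζ| ≤ lam)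
    (hv : c + s * v - ζ * (v - y) ≤ e) (hu : c + s * u - ζ * (u - y) ≤ e)
    (hx : x ∈ Set.Icc u v) : c + s * x - lam * |x - y| ≤ e := by
  have hle : ζ * (x - y) ≤ lam * |x - y| :=
    (le_abs_self _).trans (by rw [abs_mul]; gcongr)
  have hx' : c + s * x - ζ * (x - y) ≤ e := by
    rcases le_total 0 (s - ζ) with hs | hs
    · nlinarith [mul_le_mul_of_nonneg_left hx.2 hs]
    · nlinarith [mul_le_mul_of_nonpos_left hx.1 hs]
  linarith

/-- Every point of `[w 0, w p]` lies in some `[w (j - 1), w j)` with `j ≤ p`, or equals `w p`. -/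
theorem exists_mem_Ico_or_eq_of_mem_Icc (w : ℕ → ℝ) (p : ℕ) {x : ℝ}
    (hx : x ∈ Set.Icc (w 0) (w p)) :
    (∃ j, 1 ≤ j ∧ j ≤ p ∧ x ∈ Set.Ico (w (j - 1)) (w j)) ∨ x = w p := by
  induction p with
  | zero => exact Or.inr (le_antisymm hx.2 hx.1)
  | succ p ih =>
    rcases le_or_gt (w p) x with h | h
    · rcases hx.2.lt_or_eq with h' | h'
      · exact Or.inl ⟨p + 1, by omega, le_rfl, h, h'⟩
      · exact Or.inr h'
    · rcases ih ⟨hx.1, h.le⟩ with ⟨j, hj, hjp, hxj⟩ | rfl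
      · exact Or.inl ⟨j, hj, by omega, hxj⟩
      · exact absurd h (lt_irrefl _)

/-- Each continuous lifting coordinate is affine on each piece `[w (j - 1), w j]`. -/
theorem exists_affine_lifting_coord (w : ℕ → ℝ) (p : ℕ) (hw : StrictMonoOn w (Set.Iic p))
    (V : ℕ → ℝ → ℝ) (hV1 : ∀ x, V 1 x = min x (w 1))
    (hVj : ∀ j, 2 ≤ j → ∀ x, V j x = max (min x (w j) - w (j - 1)) 0)
    {j k : ℕ} (hj : 1 ≤ j) (hjp : j ≤ p) (hk : 1 ≤ k) (hkp : k ≤ p) :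
    ∃ c s : ℝ, ∀ x ∈ Set.Icc (w (j - 1)) (w j), V k x = c + s * x := by
  have hmono : ∀ {a b : ℕ}, a ≤ b → b ≤ p → w a ≤ w b := fun hab hb =>
    hw.monotoneOn (hab.trans hb) hb hab
  rcases lt_trichotomy k j with hkj | rfl | hkj
  · have hwk := hmono (show k ≤ j - 1 by omega) (by omega)
    rcases hk.eq_or_lt with rfl | hk2
    · exact ⟨w 1, 0, fun x hx => by rw [hV1, min_eq_right (hwk.trans hx.1)]; ring⟩
    · refine ⟨w k - w (k - 1), 0, fun x hx => ?_⟩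
      have := hmono (Nat.sub_le k 1) hkp
      rw [hVj k hk2, min_eq_right (hwk.trans hx.1), max_eq_left (by linarith)]
      ring
  · rcases hk.eq_or_lt with rfl | hk2
    · exact ⟨0, 1, fun x hx => by rw [hV1, min_eq_left hx.2]; ring⟩
    · refine ⟨-w (k - 1), 1, fun x hx => ?_⟩
      rw [hVj k hk2, min_eq_left hx.2, max_eq_left (by linarith [hx.1])]
      ring
  · refine ⟨0, 0, fun x hx => ?_⟩
    have := hmono (show j ≤ k - 1 by omega) (by omega)
    rw [hVj k (by omega), max_eq_right]
    · ring
    · linarith [min_le_left x (w k), hx.2]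


/-- **Lemma 1.** With `f(ξ) = max_m [ Σᵢ g_{m,i}·Gᵢ(ξᵢ) + h_m ]`, the
robust epigraph condition `η ≥ sup_{ξ ∈ Ξ} [ f(ξ) − λ‖ξ − ξ̂‖₁ ]` holds iff there exist
`η_{m,i}` and `ζ_{m,i,j} ∈ [−λ,λ]` satisfying the finite system of linear inequalities
written through the endpoint values `g_{m,i}·φ⁻_{i,j}` (= `dφm m i j`) and
`g_{m,i}·φ_{i,j−1}` (= `dφ m i (j-1)`), recalling `R φ⁻_{i,j} = w i j` and
`R φ_{i,j-1} = w i (j-1)`. -/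
theorem stmt_6 (n M : ℕ) (hM : 1 ≤ M)
    (p : Fin n → ℕ) (hp : ∀ i, 1 ≤ p i)
    (w : Fin n → ℕ → ℝ) (hw : ∀ i, ∀ j < p i, w i j < w i (j + 1))
    (V : Fin n → ℕ → ℝ → ℝ)
    (hV1 : ∀ i (x : ℝ), V i 1 x = min x (w i 1))
    (hVj : ∀ i j, 2 ≤ j → ∀ x : ℝ, V i j x = max (min x (w i j) - w i (j - 1)) 0)
    (Q : Fin n → ℕ → ℝ → ℝ)
    (hQ : ∀ i j (x : ℝ), Q i j x = if w i j ≤ x then 1 else 0)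
    (gV gQ : Fin M → Fin n → ℕ → ℝ) (hm : Fin M → ℝ)
    (lam : ℝ) (hlam : 0 ≤ lam) (ξhat : Fin n → ℝ) (η : ℝ)
    (dG : Fin M → Fin n → ℝ → ℝ)
    (hdG : ∀ m i (x : ℝ), dG m i x = (∑ j ∈ Finset.Icc 1 (p i), gV m i j * V i j x)
        + ∑ j ∈ Finset.Icc 1 (p i - 1), gQ m i j * Q i j x)
    (dφ : Fin M → Fin n → ℕ → ℝ) (hdφ : ∀ m i j, dφ m i j = dG m i (w i j))
    (dφm : Fin M → Fin n → ℕ → ℝ)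
    (hdφm : ∀ m i j, dφm m i j = (∑ k ∈ Finset.Icc 1 (p i), gV m i k * V i k (w i j))
        + ∑ k ∈ Finset.Icc 1 (p i - 1), gQ m i k * (if k < j then 1 else 0))
    (f : (Fin n → ℝ) → ℝ)
    (hf : ∀ ξ : Fin n → ℝ, f ξ = Finset.univ.sup'
        (Finset.univ_nonempty_iff.mpr ⟨⟨0, hM⟩⟩)
        (fun m : Fin M => (∑ i, dG m i (ξ i)) + hm m)) :
    (∀ ξ ∈ Set.univ.pi fun i => Set.Icc (w i 0) (w i (p i)),
        f ξ - lam * ∑ i, |ξ i - ξhat i| ≤ η)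
    ↔ ∃ (ηm : Fin M → Fin n → ℝ) (ζ : Fin M → Fin n → ℕ → ℝ),
        (∀ m i j, 1 ≤ j → j ≤ p i → |ζ m i j| ≤ lam)
        ∧ (∀ m, (∑ i, ηm m i) + hm m ≤ η)
        ∧ (∀ m i j, 1 ≤ j → j ≤ p i →
            dφm m i j - ζ m i j * (w i j - ξhat i) ≤ ηm m i
            ∧ dφ m i (j - 1) - ζ m i j * (w i (j - 1) - ξhat i) ≤ ηm m i) := by
  have hmono : ∀ i, StrictMonoOn (w i) (Set.Iic (p i)) := fun i =>
    strictMonoOn_Iic_of_lt_succ fun j hj => hw i j hj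
  have hpiece : ∀ m i j, 1 ≤ j → j ≤ p i → ∃ c s : ℝ,
      (∀ x ∈ Set.Ico (w i (j - 1)) (w i j), dG m i x = c + s * x)
        ∧ dφm m i j = c + s * w i j := by
    intro m i j hj hjp
    have hcoord : ∀ k, ∃ c s : ℝ, k ∈ Finset.Icc 1 (p i) →
        ∀ x ∈ Set.Icc (w i (j - 1)) (w i j), V i k x = c + s * x := by
      intro k
      by_cases hk : k ∈ Finset.Icc 1 (p i)
      · obtain ⟨c, s, h⟩ := exists_affine_lifting_coord (w i) (p i) (hmono i) (V i) (hV1 i)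
          (hVj i) hj hjp (Finset.mem_Icc.mp hk).1 (Finset.mem_Icc.mp hk).2
        exact ⟨c, s, fun _ => h⟩
      · exact ⟨0, 0, fun h => absurd h hk⟩
    choose c s hcs using hcoord
    have hV : ∀ x ∈ Set.Icc (w i (j - 1)) (w i j), ∑ k ∈ Finset.Icc 1 (p i), gV m i k * V i k x
        = ∑ k ∈ Finset.Icc 1 (p i), gV m i k * c k
          + (∑ k ∈ Finset.Icc 1 (p i), gV m i k * s k) * x := by
      intro x hx
      rw [Finset.sum_mul, ← Finset.sum_add_distrib]
      refine Finset.sum_congr rfl fun k hk => ?_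
      rw [hcs k hk x hx]
      ring
    have hlt : w i (j - 1) < w i j :=
      hmono i (show j - 1 ≤ p i by omega) hjp (by omega)
    refine ⟨∑ k ∈ Finset.Icc 1 (p i), gV m i k * c k
        + ∑ k ∈ Finset.Icc 1 (p i - 1), gQ m i k * (if k < j then 1 else 0),
      ∑ k ∈ Finset.Icc 1 (p i), gV m i k * s k, fun x hx => ?_, ?_⟩
    · have hQsum : ∑ k ∈ Finset.Icc 1 (p i - 1), gQ m i k * Q i k x
          = ∑ k ∈ Finset.Icc 1 (p i - 1), gQ m i k * (if k < j then 1 else 0) := by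
        refine Finset.sum_congr rfl fun k hk => ?_
        have hkp : k ≤ p i := (Finset.mem_Icc.mp hk).2.trans (Nat.sub_le _ _)
        have hiff : w i k ≤ x ↔ k < j := by
          constructor
          · intro h
            by_contra! hjk
            exact absurd (h.trans_lt hx.2) (not_lt.mpr ((hmono i).monotoneOn hjp hkp hjk))
          · intro h
            exact ((hmono i).monotoneOn hkp (show j - 1 ≤ p i by omega)
              (by omega)).trans hx.1
        simp only [hQ, hiff]
      rw [hdG, hV x ⟨hx.1, hx.2.le⟩, hQsum]
      ring
    · rw [hdφm, hV _ ⟨hlt.le, le_rfl⟩]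
      ring
  have hlast : ∀ m i, dG m i (w i (p i)) = dφm m i (p i) := by
    intro m i
    rw [hdG, hdφm]
    congr 1
    refine Finset.sum_congr rfl fun k hk => ?_
    have hk' := Finset.mem_Icc.mp hk
    have hle : w i k ≤ w i (p i) :=
      (hmono i).monotoneOn (show k ≤ p i by omega) (le_refl (p i)) (by omega)
    rw [hQ, if_pos hle, if_pos (by omega)]
  have hpen : ∀ m (ξ : Fin n → ℝ), ∑ i, (dG m i (ξ i) - lam * |ξ i - ξhat i|)
      = ∑ i, dG m i (ξ i) - lam * ∑ i, |ξ i - ξhat i| := fun m ξ => by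
    rw [Finset.sum_sub_distrib, Finset.mul_sum]
  constructor
  · intro h
    have hsep : ∀ m, ∃ e : Fin n → ℝ, ∑ i, e i ≤ η - hm m ∧
        ∀ i, ∀ x ∈ Set.Icc (w i 0) (w i (p i)), dG m i x - lam * |x - ξhat i| ≤ e i := by
      intro m
      refine exists_separate_bounds (fun i => Set.Icc (w i 0) (w i (p i)))
        (fun i => Set.nonempty_Icc.mpr ((hmono i).monotoneOn (Nat.zero_le (p i))
          (le_refl (p i)) (Nat.zero_le _))) _ _ fun ξ hξ => ?_
      have hle := Finset.le_sup' (fun m : Fin M => (∑ i, dG m i (ξ i)) + hm m)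
        (Finset.mem_univ m)
      rw [← hf] at hle
      have := h ξ hξ
      rw [hpen]
      linarith
    choose e hsum he using hsep
    have hslope : ∀ m i j, ∃ ζ : ℝ, 1 ≤ j → j ≤ p i → |ζ| ≤ lam
        ∧ dφm m i j - ζ * (w i j - ξhat i) ≤ e m i
        ∧ dφ m i (j - 1) - ζ * (w i (j - 1) - ξhat i) ≤ e m i := by
      intro m i j
      by_cases hj : 1 ≤ j ∧ j ≤ p i
      · obtain ⟨c, s, hcs, hc⟩ := hpiece m i j hj.1 hj.2
        have hlt : w i (j - 1) < w i j :=
          hmono i (show j - 1 ≤ p i by omega) hj.2 (by omega)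
        obtain ⟨ζ, hζ, h₁, h₂⟩ := exists_slope_of_affine_sub_abs_le (c := c) (s := s)
          (y := ξhat i) (e := e m i) hlt hlam fun x hx => by
            rw [← hcs x hx]
            exact he m i x ⟨((hmono i).monotoneOn (Nat.zero_le (p i))
              (show j - 1 ≤ p i by omega) (Nat.zero_le _)).trans hx.1,
              hx.2.le.trans ((hmono i).monotoneOn hj.2 (le_refl (p i)) hj.2)⟩
        refine ⟨ζ, fun _ _ => ⟨hζ, ?_, ?_⟩⟩
        · rwa [hc]
        · rwa [hdφ, hcs _ ⟨le_rfl, hlt⟩]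
      · exact ⟨0, fun h₁ h₂ => absurd ⟨h₁, h₂⟩ hj⟩
    choose ζ hζ using hslope
    exact ⟨e, ζ, fun m i j h₁ h₂ => (hζ m i j h₁ h₂).1, fun m => by linarith [hsum m],
      fun m i j h₁ h₂ => (hζ m i j h₁ h₂).2⟩
  · rintro ⟨e, ζ, hζ, hsum, he⟩ ξ hξ
    rw [sub_le_iff_le_add, hf]
    refine Finset.sup'_le _ _ fun m _ => ?_
    have hcoord : ∀ i, dG m i (ξ i) - lam * |ξ i - ξhat i| ≤ e m i := by
      intro i
      obtain ⟨j, hj, hjp, hxj, hx⟩ : ∃ j, 1 ≤ j ∧ j ≤ p i ∧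
          ξ i ∈ Set.Icc (w i (j - 1)) (w i j) ∧
          ∀ c s : ℝ, (∀ x ∈ Set.Ico (w i (j - 1)) (w i j), dG m i x = c + s * x) →
            dφm m i j = c + s * w i j → dG m i (ξ i) = c + s * ξ i := by
        rcases exists_mem_Ico_or_eq_of_mem_Icc (w i) (p i) (hξ i (Set.mem_univ i)) with
          ⟨j, hj, hjp, hxj⟩ | hx
        · exact ⟨j, hj, hjp, ⟨hxj.1, hxj.2.le⟩, fun c s hcs _ => hcs _ hxj⟩
        · refine ⟨p i, hp i, le_rfl, ?_, fun c s _ hc => by rw [hx, hlast, hc]⟩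
          rw [hx]
          exact ⟨(hmono i).monotoneOn (Nat.sub_le (p i) 1) (le_refl (p i)) (Nat.sub_le _ _),
            le_rfl⟩
      obtain ⟨c, s, hcs, hc⟩ := hpiece m i j hj hjp
      obtain ⟨h₁, h₂⟩ := he m i j hj hjp
      have hlt : w i (j - 1) < w i j :=
        hmono i (show j - 1 ≤ p i by omega) hjp (by omega)
      rw [hc] at h₁
      rw [hdφ, hcs _ ⟨le_rfl, hlt⟩] at h₂
      rw [hx c s hcs hc]
      exact affine_sub_abs_le_of_slope (hζ m i j hj hjp) h₁ h₂ hxj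
    have hle := Finset.sum_le_sum fun i (_ : i ∈ Finset.univ) => hcoord i
    rw [hpen] at hle
    linarith [hsum m]
end

section
/- (Theorem 1: asymptotic performance of the lifted control policy.) Assume that for every π^γ ∈ 𝔑^γ for which some pair (π^u, π^γ) with π^u ∈ 𝔑^u is feasible, the set 𝔄(π^γ) = {π^u ∈ 𝔑^u : (π^u, π^γ) is feasible} has nonempty interior in the metric space (𝔑^u, d). Then inf_w J*(Π^u(w) × Π^γ(w)) = J*(𝔑^u × 𝔑^γ), where the infimum is over all breakpoint vectors w. Equivalently, with ε(w) = max_{t,i,j} (w_{t,i,j} − w_{t,i,j−1}), lim_{δ↓0} inf_{w : ε(w) ≥ δ} J*(Π^u(w) × Π^γ(w)) = J*(𝔑^u × 𝔑^γ). -/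
open MeasureTheory

namespace Stmt12

/-- The data of the uncertain mixed-integer linear control problem: horizon `T`,
dimensions, box support `∏ [l t i, v t i]`, dynamics matrices `A, B, C, Dm` and initial
state `xbar`, constraint matrices `At, Bt, Ct, Dt` with right-hand side `q`, stage costs
`c` and discount weights `α`. -/
structure Sys where
  T : ℕ
  nx : ℕ
  nu : ℕ
  ng : ℕ
  nxi : ℕ
  nc : ℕ
  l : Fin T → Fin nxi → ℝ
  v : Fin T → Fin nxi → ℝ
  A : Fin T → Matrix (Fin nx) (Fin nx) ℝ
  B : Fin T → Matrix (Fin nx) (Fin nu) ℝ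
  C : Fin T → Matrix (Fin nx) (Fin ng) ℝ
  Dm : Fin T → Matrix (Fin nx) (Fin nxi) ℝ
  xbar : Fin nx → ℝ
  At : Fin T → Matrix (Fin nc) (Fin nx) ℝ
  Bt : Fin T → Matrix (Fin nc) (Fin nu) ℝ
  Ct : Fin T → Matrix (Fin nc) (Fin ng) ℝ
  Dt : Fin T → Matrix (Fin nc) (Fin nxi) ℝ
  q : Fin nc → ℝ
  c : Fin T → (Fin nx → ℝ) → (Fin nu → ℝ) → (Fin ng → ℝ) → ℝ
  α : Fin T → ℝ

/-- Disturbance trajectories. -/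
abbrev Sys.Traj (S : Sys) : Type := Fin S.T → Fin S.nxi → ℝ

/-- Causal continuous control policies are encoded as maps of the whole trajectory;
membership in the policy classes below enforces causality. -/
abbrev Sys.ContPol (S : Sys) : Type := Fin S.T → S.Traj → Fin S.nu → ℝ

abbrev Sys.IntPol (S : Sys) : Type := Fin S.T → S.Traj → Fin S.ng → ℤ

/-- The box support `Ξ`. -/
def Sys.Xi (S : Sys) : Set S.Traj :=
  {ξ | ∀ t i, ξ t i ∈ Set.Icc (S.l t i) (S.v t i)}

/-- State sequence: index `0` carries `x₁ = x̄`, and for `t < T`,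
`x (t+1) = A t (x t) + B t (u t) + C t (γ t) + Dm t (ξ t)`. -/
def Sys.state (S : Sys) (u : S.ContPol) (γ : S.IntPol) (ξ : S.Traj) :
    ℕ → Fin S.nx → ℝ
  | 0 => S.xbar
  | t + 1 =>
    if h : t < S.T then
      (S.A ⟨t, h⟩).mulVec (S.state u γ ξ t)
        + (S.B ⟨t, h⟩).mulVec (u ⟨t, h⟩ ξ)
        + (S.C ⟨t, h⟩).mulVec (fun k => ((γ ⟨t, h⟩ ξ k : ℤ) : ℝ))
        + (S.Dm ⟨t, h⟩).mulVec (ξ ⟨t, h⟩)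
    else S.xbar

/-- Feasibility: the robust linear constraint holds for all `ξ ∈ Ξ`. -/
def Sys.Feas (S : Sys) (u : S.ContPol) (γ : S.IntPol) : Prop :=
  ∀ ξ ∈ S.Xi, ∀ m : Fin S.nc,
    (∑ t : Fin S.T,
      ((S.At t).mulVec (S.state u γ ξ (t : ℕ))
        + (S.Bt t).mulVec (u t ξ)
        + (S.Ct t).mulVec (fun k => ((γ t ξ k : ℤ) : ℝ))
        + (S.Dt t).mulVec (ξ t)) m) ≤ S.q m

/-- Worst-case expected discounted cost over the ambiguity set `ℬ`. -/
noncomputable def Sys.J (S : Sys) (ℬ : Set (Measure S.Traj))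
    (u : S.ContPol) (γ : S.IntPol) : EReal :=
  ⨆ P ∈ ℬ,
    ((∫ ξ, ∑ t : Fin S.T, S.α t * S.c t (S.state u γ ξ (t : ℕ)) (u t ξ)
        (fun k => ((γ t ξ k : ℤ) : ℝ)) ∂P : ℝ) : EReal)

/-- Optimal value over a class of policy pairs (`⊤` if no feasible pair exists). -/
noncomputable def Sys.Jstar (S : Sys) (ℬ : Set (Measure S.Traj))
    (Au : Set S.ContPol) (Ag : Set S.IntPol) : EReal :=
  sInf ((fun pr : S.ContPol × S.IntPol => S.J ℬ pr.1 pr.2) ''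
    {pr | pr.1 ∈ Au ∧ pr.2 ∈ Ag ∧ S.Feas pr.1 pr.2})

/-- Additive continuous control policies `𝔑ᵘ`. -/
def Sys.Ncont (S : Sys) : Set S.ContPol :=
  {u | ∃ f : Fin S.T → Fin S.nu → Fin S.T → Fin S.nxi → ℝ → ℝ,
    (∀ t j t' i, ContinuousOn (f t j t' i) (Set.Icc (S.l t' i) (S.v t' i))) ∧
    ∀ t ξ j, u t ξ j
      = ∑ t' ∈ Finset.univ.filter (· ≤ t), ∑ i, f t j t' i (ξ t' i)}

/-- A piecewise integer function on `[l, v]`: constant on each piece of a finite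
partition into consecutive half-open intervals, the last piece closed. -/
def PiecewiseInt (l v : ℝ) (f : ℝ → ℤ) : Prop :=
  ∃ q : ℕ, 1 ≤ q ∧ ∃ s : ℕ → ℝ, s 0 = l ∧ s q = v ∧ (∀ k < q, s k < s (k + 1)) ∧
    (∀ k, 1 ≤ k → k < q → ∀ x ∈ Set.Ico (s (k - 1)) (s k), f x = f (s (k - 1))) ∧
    (∀ x ∈ Set.Icc (s (q - 1)) (s q), f x = f (s (q - 1)))

/-- Additive integer control policies `𝔑^γ` with piecewise-integer terms. -/
def Sys.Nint (S : Sys) : Set S.IntPol :=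
  {γ | ∃ f : Fin S.T → Fin S.ng → Fin S.T → Fin S.nxi → ℝ → ℤ,
    (∀ t j t' i, PiecewiseInt (S.l t' i) (S.v t' i) (f t j t' i)) ∧
    ∀ t ξ j, γ t ξ j
      = ∑ t' ∈ Finset.univ.filter (· ≤ t), ∑ i, f t j t' i (ξ t' i)}

/-- A breakpoint vector `w`: for each `(t, i)` a number of segments `p t i ≥ 1` and
strictly increasing breakpoints from `l t i` to `v t i`. -/
structure Sys.Brk (S : Sys) where
  p : Fin S.T → Fin S.nxi → ℕ
  hp : ∀ t i, 1 ≤ p t i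
  w : Fin S.T → Fin S.nxi → ℕ → ℝ
  h0 : ∀ t i, w t i 0 = S.l t i
  hv : ∀ t i, w t i (p t i) = S.v t i
  hmono : ∀ t i j, j < p t i → w t i j < w t i (j + 1)

/-- Continuous components of the lifting induced by a breakpoint vector. -/
noncomputable def Sys.Vfun (S : Sys) (b : S.Brk) (t : Fin S.T) (i : Fin S.nxi)
    (j : ℕ) (x : ℝ) : ℝ :=
  if j = 1 then min x (b.w t i 1) else max (min x (b.w t i j) - b.w t i (j - 1)) 0

/-- Binary components of the lifting induced by a breakpoint vector. -/
noncomputable def Sys.Qfun (S : Sys) (b : S.Brk) (t : Fin S.T) (i : Fin S.nxi)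
    (j : ℕ) (x : ℝ) : ℤ :=
  if b.w t i j ≤ x then 1 else 0

/-- Lifted continuous control policies `Πᵘ(w)`. -/
def Sys.PiU (S : Sys) (b : S.Brk) : Set S.ContPol :=
  {u | ∃ (Y : Fin S.T → Fin S.nu → Fin S.T → Fin S.nxi → ℕ → ℝ)
        (y0 : Fin S.T → Fin S.nu → ℝ),
    ∀ t ξ j, u t ξ j = y0 t j
      + ∑ t' ∈ Finset.univ.filter (· ≤ t), ∑ i,
          ∑ k ∈ Finset.Icc 1 (b.p t' i), Y t j t' i k * S.Vfun b t' i k (ξ t' i)}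

/-- Lifted integer control policies `Π^γ(w)`. -/
def Sys.PiG (S : Sys) (b : S.Brk) : Set S.IntPol :=
  {γ | ∃ (Z : Fin S.T → Fin S.ng → Fin S.T → Fin S.nxi → ℕ → ℤ)
        (z0 : Fin S.T → Fin S.ng → ℤ),
    ∀ t ξ j, γ t ξ j = z0 t j
      + ∑ t' ∈ Finset.univ.filter (· ≤ t), ∑ i,
          ∑ k ∈ Finset.Icc 1 (b.p t' i - 1), Z t j t' i k * S.Qfun b t' i k (ξ t' i)}

/-- The policy (pseudo-)distance `d(π₁, π₂) = Σ_t Σ_j sup_{ξ ∈ Ξ} |u¹_{t,j} − u²_{t,j}|`. -/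
noncomputable def Sys.pdist (S : Sys) (u1 u2 : S.ContPol) : ℝ :=
  ∑ t : Fin S.T, ∑ j : Fin S.nu,
    sSup ((fun ξ => |u1 t ξ j - u2 t ξ j|) '' S.Xi)

theorem breakpoints_mono {p : ℕ} {w : ℕ → ℝ} (hw : ∀ j < p, w j < w (j + 1)) {i j : ℕ}
    (hij : i ≤ j) (hj : j ≤ p) : w i ≤ w j := by
  induction j, hij using Nat.le_induction with
  | base => exact le_rfl
  | succ k hk ih => exact (ih (by omega)).trans (hw k (by omega)).le

theorem exists_piece {p : ℕ} (hp : 1 ≤ p) {w : ℕ → ℝ} {x : ℝ} (hx : x ∈ Set.Icc (w 0) (w p)) :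
    ∃ j < p, w j ≤ x ∧ x ≤ w (j + 1) ∧ (j + 1 < p → x < w (j + 1)) := by
  classical
  have hle : Nat.findGreatest (fun k => w k ≤ x) (p - 1) ≤ p - 1 := Nat.findGreatest_le _
  have hspec : w (Nat.findGreatest (fun k => w k ≤ x) (p - 1)) ≤ x :=
    Nat.findGreatest_spec (P := fun k => w k ≤ x) (Nat.zero_le (p - 1)) hx.1
  have hlt : Nat.findGreatest (fun k => w k ≤ x) (p - 1) + 1 < p →
      x < w (Nat.findGreatest (fun k => w k ≤ x) (p - 1) + 1) := fun h =>
    not_le.1 (Nat.findGreatest_is_greatest (P := fun k => w k ≤ x) (Nat.lt_succ_self _)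
      (by omega))
  refine ⟨_, by omega, hspec, ?_, hlt⟩
  rcases Nat.lt_or_ge (Nat.findGreatest (fun k => w k ≤ x) (p - 1) + 1) p with h | h
  · exact (hlt h).le
  · rw [show Nat.findGreatest (fun k => w k ≤ x) (p - 1) + 1 = p by omega]
    exact hx.2

theorem exists_breakpoints {l v : ℝ} (hlv : l < v) (E : Finset ℝ) :
    ∃ p : ℕ, 1 ≤ p ∧ ∃ w : ℕ → ℝ, w 0 = l ∧ w p = v ∧ (∀ j < p, w j < w (j + 1)) ∧
      ∀ j < p, ∀ e ∈ E, e ∉ Set.Ioo (w j) (w (j + 1)) := by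
  classical
  set G : Finset ℝ := insert l (insert v (E.filter (fun e => e ∈ Set.Ioo l v))) with hG
  have hlG : l ∈ G := by simp [hG]
  have hvG : v ∈ G := by simp [hG]
  have hGsub : ∀ x ∈ G, l ≤ x ∧ x ≤ v := by
    intro x hx
    simp only [hG, Finset.mem_insert, Finset.mem_filter, Set.mem_Ioo] at hx
    rcases hx with rfl | rfl | ⟨-, h1, h2⟩
    · exact ⟨le_rfl, hlv.le⟩
    · exact ⟨hlv.le, le_rfl⟩
    · exact ⟨h1.le, h2.le⟩
  have hcard : 1 < G.card := Finset.one_lt_card.2 ⟨l, hlG, v, hvG, hlv.ne⟩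
  set φ := G.orderEmbOfFin rfl with hφ
  have hφmem : ∀ a, φ a ∈ G := fun a => G.orderEmbOfFin_mem rfl a
  have hφsurj : ∀ e ∈ G, ∃ a, φ a = e := by
    intro e he
    have : e ∈ Set.range φ := by rw [hφ, Finset.range_orderEmbOfFin]; exact he
    exact this
  have hw : ∀ k (h : k < G.card),
      (fun k => if h : k < G.card then φ ⟨k, h⟩ else 0 : ℕ → ℝ) k = φ ⟨k, h⟩ :=
    fun k h => dif_pos h
  refine ⟨G.card - 1, by omega, fun k => if h : k < G.card then φ ⟨k, h⟩ else 0, ?_, ?_, ?_, ?_⟩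
  · rw [hw 0 (by omega)]
    obtain ⟨a, ha⟩ := hφsurj l hlG
    refine le_antisymm ?_ (hGsub _ (hφmem _)).1
    exact (φ.monotone (Fin.mk_le_of_le_val (Nat.zero_le _))).trans ha.le
  · rw [hw (G.card - 1) (by omega)]
    obtain ⟨a, ha⟩ := hφsurj v hvG
    refine le_antisymm (hGsub _ (hφmem _)).2 ?_
    exact ha.ge.trans (φ.monotone (Fin.le_def.2 (by have := a.2; simp only; omega)))
  · intro j hj
    rw [hw j (by omega), hw (j + 1) (by omega)]
    exact φ.strictMono (Fin.lt_def.2 (Nat.lt_succ_self j))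
  · intro j hj e he hmem
    rw [hw j (by omega), hw (j + 1) (by omega)] at hmem
    have heG : e ∈ G := by
      simp only [hG, Finset.mem_insert, Finset.mem_filter, Set.mem_Ioo]
      exact Or.inr (Or.inr ⟨he, (hGsub _ (hφmem _)).1.trans_lt hmem.1,
        hmem.2.trans_le (hGsub _ (hφmem _)).2⟩)
    obtain ⟨a, rfl⟩ := hφsurj e heG
    have h1 := Fin.lt_def.1 (φ.lt_iff_lt.1 hmem.1)
    have h2 := Fin.lt_def.1 (φ.lt_iff_lt.1 hmem.2)
    simp only at h1 h2
    omega

/-- A piecewise integer function only changes value across finitely many points, none of which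
is the right end of the interval. -/
theorem PiecewiseInt.exists_finset {l v : ℝ} {f : ℝ → ℤ} (hf : PiecewiseInt l v f) :
    ∃ E : Finset ℝ, v ∉ E ∧ ∀ x y, l ≤ x → x ≤ y → y ≤ v →
      (∀ e ∈ E, e ∉ Set.Ioc x y) → f x = f y := by
  classical
  obtain ⟨q, hq, s, hs0, hsq, hs, hpiece, hlast⟩ := hf
  refine ⟨(Finset.Icc 1 (q - 1)).image s, ?_, ?_⟩
  · intro hv
    obtain ⟨k, hk, hkv⟩ := Finset.mem_image.1 hv
    rw [Finset.mem_Icc] at hk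
    have h1 := hs k (by omega)
    have h2 := breakpoints_mono hs (show k + 1 ≤ q by omega) le_rfl
    rw [hsq] at h2
    linarith
  · intro x y hlx hxy hyv hE
    obtain ⟨j, hj, hjx, -, hjlt⟩ := exists_piece hq (w := s) (x := x)
      ⟨hs0.le.trans hlx, (hxy.trans hyv).trans hsq.ge⟩
    rcases Nat.lt_or_ge (j + 1) q with h | h
    · have hxlt := hjlt h
      have hylt : y < s (j + 1) := by
        by_contra! hy
        exact hE (s (j + 1)) (Finset.mem_image_of_mem s (Finset.mem_Icc.2 (by omega)))
          ⟨hxlt, hy⟩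
      have key := hpiece (j + 1) (by omega) h
      simp only [Nat.add_sub_cancel] at key
      rw [key x ⟨hjx, hxlt⟩, key y ⟨hjx.trans hxy, hylt⟩]
    · obtain rfl : j = q - 1 := by omega
      rw [hlast x ⟨hjx, (hxy.trans hyv).trans hsq.ge⟩,
        hlast y ⟨hjx.trans hxy, hyv.trans hsq.ge⟩]

/-- A continuous function varies little between points not separated by a suitable finite set. -/
theorem exists_finset_abs_sub_le {l v : ℝ} {f : ℝ → ℝ} (hf : ContinuousOn f (Set.Icc l v))
    {η : ℝ} (hη : 0 < η) :
    ∃ E : Finset ℝ, ∀ x y, l ≤ x → x ≤ y → y ≤ v →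
      (∀ e ∈ E, e ∉ Set.Ioo x y) → |f x - f y| ≤ η := by
  have huc := isCompact_Icc.uniformContinuousOn_of_continuous hf
  obtain ⟨δ, hδ, hδf⟩ := Metric.uniformContinuousOn_iff.1 huc η hη
  obtain ⟨t, -, htfin, hcover⟩ := (isCompact_Icc (a := l) (b := v)).finite_cover_balls
    (half_pos hδ)
  refine ⟨htfin.toFinset, fun x y hlx hxy hyv hE => ?_⟩
  have hlt : y - x < δ := by
    by_contra! hge
    have hmid : (x + y) / 2 ∈ Set.Icc l v := ⟨by linarith, by linarith⟩
    obtain ⟨e, he, hball⟩ := Set.mem_iUnion₂.1 (hcover hmid)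
    rw [Metric.mem_ball, Real.dist_eq, abs_lt] at hball
    exact hE e (htfin.mem_toFinset.2 he) ⟨by linarith, by linarith⟩
  have := hδf x ⟨hlx, hxy.trans hyv⟩ y ⟨hlx.trans hxy, hyv⟩
    (by rw [Real.dist_eq, abs_lt]; constructor <;> linarith)
  rw [Real.dist_eq] at this
  exact this.le

theorem sum_step_eq {p : ℕ} {w : ℕ → ℝ} (hw : ∀ j < p, w j < w (j + 1)) (g : ℕ → ℤ) {x : ℝ}
    {j : ℕ} (hj : j < p) (hjx : w j ≤ x) (hlt : j + 1 < p → x < w (j + 1)) :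
    ∑ k ∈ Finset.Icc 1 (p - 1), (g k - g (k - 1)) * (if w k ≤ x then 1 else 0)
      = g j - g 0 := by
  have key : ∀ n ≤ p - 1, ∑ k ∈ Finset.Icc 1 n, (g k - g (k - 1)) * (if w k ≤ x then 1 else 0)
      = g (min n j) - g 0 := by
    intro n
    induction n with
    | zero => simp
    | succ n ih =>
      intro hn
      rw [Finset.sum_Icc_succ_top (by omega), ih (by omega)]
      rcases Nat.lt_or_ge n j with h | h
      · rw [if_pos ((breakpoints_mono hw (show n + 1 ≤ j by omega) hj.le).trans hjx),
          min_eq_left h.le, min_eq_left (show n + 1 ≤ j by omega)]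
        simp
      · have : x < w (n + 1) := (hlt (by omega)).trans_le
          (breakpoints_mono hw (show j + 1 ≤ n + 1 by omega) (by omega))
        rw [if_neg this.not_ge, min_eq_right h, min_eq_right (by omega : j ≤ n + 1)]
        simp
  rw [key _ le_rfl, min_eq_right (by omega)]

theorem sum_ramp_eq {p : ℕ} {w : ℕ → ℝ} (hw : ∀ j < p, w j < w (j + 1)) (g : ℕ → ℝ) {x : ℝ}
    {j : ℕ} (hj : j < p) (hjx : w j ≤ x) (hxj : x ≤ w (j + 1)) :
    ∑ k ∈ Finset.Icc 1 p, (g k - g (k - 1)) / (w k - w (k - 1)) *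
        max (min x (w k) - w (k - 1)) 0
      = g j - g 0 + (g (j + 1) - g j) / (w (j + 1) - w j) * (x - w j) := by
  have key : ∀ n ≤ p, ∑ k ∈ Finset.Icc 1 n, (g k - g (k - 1)) / (w k - w (k - 1)) *
        max (min x (w k) - w (k - 1)) 0
      = if n ≤ j then g n - g 0
        else g j - g 0 + (g (j + 1) - g j) / (w (j + 1) - w j) * (x - w j) := by
    intro n
    induction n with
    | zero => simp
    | succ n ih =>
      intro hn
      rw [Finset.sum_Icc_succ_top (by omega), ih (by omega)]
      simp only [Nat.add_sub_cancel]
      have hstep := hw n (by omega)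
      rcases lt_trichotomy n j with h | rfl | h
      · rw [if_pos h.le, if_pos (by omega), min_eq_right
          ((breakpoints_mono hw (show n + 1 ≤ j by omega) hj.le).trans hjx),
          max_eq_left (by linarith), div_mul_cancel₀ _ (by linarith)]
        ring
      · rw [if_pos le_rfl, if_neg (by omega), min_eq_left hxj, max_eq_left (by linarith)]
      · have hle := breakpoints_mono hw (show j + 1 ≤ n by omega) (by omega)
        rw [if_neg (by omega), if_neg (by omega), min_eq_left (by linarith),
          max_eq_right (by linarith)]
        simp
  rw [key p le_rfl, if_neg (by omega)]

theorem eq_add_sum_step {p : ℕ} (hp : 1 ≤ p) {w : ℕ → ℝ} (hw : ∀ j < p, w j < w (j + 1))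
    {f : ℝ → ℤ} {E : Finset ℝ} (hvE : w p ∉ E)
    (hf : ∀ x y, w 0 ≤ x → x ≤ y → y ≤ w p → (∀ e ∈ E, e ∉ Set.Ioc x y) → f x = f y)
    (hE : ∀ j < p, ∀ e ∈ E, e ∉ Set.Ioo (w j) (w (j + 1)))
    {x : ℝ} (hx : x ∈ Set.Icc (w 0) (w p)) :
    f (w 0) + ∑ k ∈ Finset.Icc 1 (p - 1), (f (w k) - f (w (k - 1))) *
      (if w k ≤ x then 1 else 0) = f x := by
  obtain ⟨j, hj, hjx, hxj, hlt⟩ := exists_piece hp hx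
  rw [sum_step_eq hw (fun k => f (w k)) hj hjx hlt, add_sub_cancel]
  refine hf _ _ (breakpoints_mono hw (Nat.zero_le j) hj.le) hjx hx.2 fun e he hmem => ?_
  rcases hxj.lt_or_eq with h | h
  · exact hE j hj e he ⟨hmem.1, hmem.2.trans_lt h⟩
  · have hjp : j + 1 = p := by
      by_contra hne
      exact (hlt (by omega)).ne h
    rcases hmem.2.lt_or_eq with h' | h'
    · exact hE j hj e he ⟨hmem.1, h'.trans_le hxj⟩
    · rw [h', h, hjp] at he
      exact hvE he

theorem abs_interpolation_sub_le {p : ℕ} (hp : 1 ≤ p) {w : ℕ → ℝ}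
    (hw : ∀ j < p, w j < w (j + 1)) {f : ℝ → ℝ} {E : Finset ℝ} {η : ℝ}
    (hf : ∀ x y, w 0 ≤ x → x ≤ y → y ≤ w p → (∀ e ∈ E, e ∉ Set.Ioo x y) → |f x - f y| ≤ η)
    (hE : ∀ j < p, ∀ e ∈ E, e ∉ Set.Ioo (w j) (w (j + 1)))
    {x : ℝ} (hx : x ∈ Set.Icc (w 0) (w p)) :
    |(f (w 0) - (f (w 1) - f (w 0)) / (w 1 - w 0) * w 0 +
      ∑ k ∈ Finset.Icc 1 p, (f (w k) - f (w (k - 1))) / (w k - w (k - 1)) *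
        (if k = 1 then min x (w 1) else max (min x (w k) - w (k - 1)) 0)) - f x| ≤ 2 * η := by
  obtain ⟨j, hj, hjx, hxj, -⟩ := exists_piece hp hx
  have hstep := hw j hj
  have hshift : ∑ k ∈ Finset.Icc 1 p, (f (w k) - f (w (k - 1))) / (w k - w (k - 1)) *
        (if k = 1 then min x (w 1) else max (min x (w k) - w (k - 1)) 0)
      = (∑ k ∈ Finset.Icc 1 p, (f (w k) - f (w (k - 1))) / (w k - w (k - 1)) *
        max (min x (w k) - w (k - 1)) 0) + (f (w 1) - f (w 0)) / (w 1 - w 0) * w 0 := by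
    rw [← Finset.add_sum_erase _ _ (Finset.mem_Icc.2 ⟨le_rfl, hp⟩),
      ← Finset.add_sum_erase (Finset.Icc 1 p) (fun k => (f (w k) - f (w (k - 1))) /
        (w k - w (k - 1)) * max (min x (w k) - w (k - 1)) 0) (Finset.mem_Icc.2 ⟨le_rfl, hp⟩)]
    have h01 := hw 0 (by omega)
    have hcongr : ∑ k ∈ (Finset.Icc 1 p).erase 1, (f (w k) - f (w (k - 1))) /
          (w k - w (k - 1)) * (if k = 1 then min x (w 1) else max (min x (w k) - w (k - 1)) 0)
        = ∑ k ∈ (Finset.Icc 1 p).erase 1, (f (w k) - f (w (k - 1))) / (w k - w (k - 1)) *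
          max (min x (w k) - w (k - 1)) 0 :=
      Finset.sum_congr rfl fun k hk => by rw [if_neg (Finset.mem_erase.1 hk).1]
    have hmax : max (min x (w 1) - w 0) 0 = min x (w 1) - w 0 :=
      max_eq_left (sub_nonneg.2 (le_min hx.1 h01.le))
    rw [hcongr]
    simp only [if_true, Nat.sub_self, hmax]
    ring
  rw [hshift, sum_ramp_eq hw (fun k => f (w k)) hj hjx hxj]
  have h0j := breakpoints_mono hw (Nat.zero_le j) hj.le
  have hjp := breakpoints_mono hw (show j + 1 ≤ p from hj) le_rfl
  have h1 : |f (w j) - f x| ≤ η := hf _ _ h0j hjx hx.2 fun e he hmem =>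
    hE j hj e he ⟨hmem.1, hmem.2.trans_le hxj⟩
  have h2 : |f (w j) - f (w (j + 1))| ≤ η := hf _ _ h0j hstep.le hjp (hE j hj)
  have hθ0 : 0 ≤ (x - w j) / (w (j + 1) - w j) :=
    div_nonneg (by linarith) (by linarith)
  have hθ1 : (x - w j) / (w (j + 1) - w j) ≤ 1 :=
    (div_le_one (by linarith)).2 (by linarith)
  have h3 : |(x - w j) / (w (j + 1) - w j) * (f (w j) - f (w (j + 1)))| ≤ η := by
    rw [abs_mul, abs_of_nonneg hθ0]
    exact (mul_le_of_le_one_left (abs_nonneg _) hθ1).trans h2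
  calc _ = |(f (w j) - f x) - (x - w j) / (w (j + 1) - w j) * (f (w j) - f (w (j + 1)))| := by
        congr 1; ring
    _ ≤ |f (w j) - f x| + |(x - w j) / (w (j + 1) - w j) * (f (w j) - f (w (j + 1)))| :=
        abs_sub _ _
    _ ≤ 2 * η := by linarith

theorem Sys.PiU_subset_Ncont (S : Sys) (hnxi : 1 ≤ S.nxi) (b : S.Brk) : S.PiU b ⊆ S.Ncont := by
  rintro u ⟨Y, y0, hu⟩
  refine ⟨fun t j t' i x => (if t' = t ∧ i = ⟨0, hnxi⟩ then y0 t j else 0) +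
    ∑ k ∈ Finset.Icc 1 (b.p t' i), Y t j t' i k * S.Vfun b t' i k x, fun t j t' i => ?_,
    fun t ξ j => ?_⟩
  · refine Continuous.continuousOn (continuous_const.add (continuous_finsetSum _ fun k _ =>
      continuous_const.mul ?_))
    unfold Sys.Vfun
    split_ifs <;> fun_prop
  · rw [hu]
    simp only [Finset.sum_add_distrib, ite_and]
    simp

theorem Sys.PiG_subset_Nint (S : Sys) (hnxi : 1 ≤ S.nxi) (b : S.Brk) : S.PiG b ⊆ S.Nint := by
  rintro γ ⟨Z, z0, hγ⟩
  refine ⟨fun t j t' i x => (if t' = t ∧ i = ⟨0, hnxi⟩ then z0 t j else 0) +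
    ∑ k ∈ Finset.Icc 1 (b.p t' i - 1), Z t j t' i k * S.Qfun b t' i k x, fun t j t' i => ?_,
    fun t ξ j => ?_⟩
  · have hw := b.hmono t' i
    have hp := b.hp t' i
    refine ⟨b.p t' i, hp, b.w t' i, b.h0 t' i, b.hv t' i, hw, ?_, ?_⟩
    · intro k hk1 hk x hx
      simp only
      congr 1
      refine Finset.sum_congr rfl fun m hm => ?_
      rw [Finset.mem_Icc] at hm
      unfold Sys.Qfun
      rcases Nat.lt_or_ge m k with h | h
      · have h' := breakpoints_mono hw (show m ≤ k - 1 by omega) (by omega)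
        rw [if_pos (h'.trans hx.1), if_pos h']
      · have h' := breakpoints_mono hw h (by omega)
        have h'' := hw (k - 1) (by omega)
        rw [Nat.sub_add_cancel hk1] at h''
        rw [if_neg (hx.2.trans_le h').not_ge, if_neg (h''.trans_le h').not_ge]
    · intro x hx
      simp only
      congr 1
      refine Finset.sum_congr rfl fun m hm => ?_
      rw [Finset.mem_Icc] at hm
      unfold Sys.Qfun
      have h' := breakpoints_mono hw hm.2 (by omega)
      rw [if_pos (h'.trans hx.1), if_pos h']
  · rw [hγ]
    simp only [Finset.sum_add_distrib, ite_and]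
    simp

theorem Sys.exists_lift (S : Sys) (hlv : ∀ t i, S.l t i < S.v t i) {u : S.ContPol}
    (hu : u ∈ S.Ncont) {γ : S.IntPol} (hγ : γ ∈ S.Nint) {η : ℝ} (hη : 0 < η) :
    ∃ b : S.Brk, (∃ γ' ∈ S.PiG b, ∀ ξ ∈ S.Xi, ∀ t, γ' t ξ = γ t ξ) ∧
      ∃ u' ∈ S.PiU b, ∀ ξ ∈ S.Xi, ∀ t j, |u' t ξ j - u t ξ j| ≤ η := by
  classical
  obtain ⟨f, hfc, hf⟩ := hu
  obtain ⟨g, hgp, hg⟩ := hγ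
  obtain ⟨κ, hκ, hκη⟩ : ∃ κ : ℝ, 0 < κ ∧ (S.T * S.nxi : ℝ) * (2 * κ) ≤ η := by
    refine ⟨η / (2 * (S.T * S.nxi + 1)), by positivity, ?_⟩
    rw [show (S.T * S.nxi : ℝ) * (2 * (η / (2 * (S.T * S.nxi + 1))))
      = (S.T * S.nxi : ℝ) / (S.T * S.nxi + 1) * η by field_simp]
    exact mul_le_of_le_one_left hη.le ((div_le_one (by positivity)).2 (by linarith))
  choose Eu hEu using fun t j t' i => exists_finset_abs_sub_le (hfc t j t' i) hκ
  choose Eg hvEg hEg using fun t j t' i => (hgp t j t' i).exists_finset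
  choose p hp w h0 hv hw hgap using fun t' i => exists_breakpoints (hlv t' i)
    ((Finset.univ.biUnion fun t => Finset.univ.biUnion fun j => Eu t j t' i) ∪
      Finset.univ.biUnion fun t => Finset.univ.biUnion fun j => Eg t j t' i)
  have hgapu : ∀ t j t' i, ∀ k < p t' i, ∀ e ∈ Eu t j t' i,
      e ∉ Set.Ioo (w t' i k) (w t' i (k + 1)) := fun t j t' i k hk e he =>
    hgap t' i k hk e (Finset.mem_union_left _ (Finset.mem_biUnion.2
      ⟨t, Finset.mem_univ _, Finset.mem_biUnion.2 ⟨j, Finset.mem_univ _, he⟩⟩))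
  have hgapg : ∀ t j t' i, ∀ k < p t' i, ∀ e ∈ Eg t j t' i,
      e ∉ Set.Ioo (w t' i k) (w t' i (k + 1)) := fun t j t' i k hk e he =>
    hgap t' i k hk e (Finset.mem_union_right _ (Finset.mem_biUnion.2
      ⟨t, Finset.mem_univ _, Finset.mem_biUnion.2 ⟨j, Finset.mem_univ _, he⟩⟩))
  have hmem : ∀ ξ ∈ S.Xi, ∀ t' i, ξ t' i ∈ Set.Icc (w t' i 0) (w t' i (p t' i)) :=
    fun ξ hξ t' i => by rw [h0, hv]; exact hξ t' i
  refine ⟨⟨p, hp, w, h0, hv, hw⟩, ⟨fun t ξ j =>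
      ∑ t' ∈ Finset.univ.filter (· ≤ t), ∑ i, (g t j t' i (w t' i 0) +
        ∑ k ∈ Finset.Icc 1 (p t' i - 1), (g t j t' i (w t' i k) - g t j t' i (w t' i (k - 1))) *
          (if w t' i k ≤ ξ t' i then 1 else 0)),
      ⟨fun t j t' i k => g t j t' i (w t' i k) - g t j t' i (w t' i (k - 1)),
        fun t j => ∑ t' ∈ Finset.univ.filter (· ≤ t), ∑ i, g t j t' i (w t' i 0),
        fun t ξ j => ?_⟩, fun ξ hξ t => ?_⟩,
    fun t ξ j => ∑ t' ∈ Finset.univ.filter (· ≤ t), ∑ i, (f t j t' i (w t' i 0) -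
      (f t j t' i (w t' i 1) - f t j t' i (w t' i 0)) / (w t' i 1 - w t' i 0) * w t' i 0 +
      ∑ k ∈ Finset.Icc 1 (p t' i), (f t j t' i (w t' i k) - f t j t' i (w t' i (k - 1))) /
        (w t' i k - w t' i (k - 1)) * (if k = 1 then min (ξ t' i) (w t' i 1) else
          max (min (ξ t' i) (w t' i k) - w t' i (k - 1)) 0)),
    ⟨fun t j t' i k => (f t j t' i (w t' i k) - f t j t' i (w t' i (k - 1))) /
        (w t' i k - w t' i (k - 1)),
      fun t j => ∑ t' ∈ Finset.univ.filter (· ≤ t), ∑ i, (f t j t' i (w t' i 0) -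
        (f t j t' i (w t' i 1) - f t j t' i (w t' i 0)) / (w t' i 1 - w t' i 0) * w t' i 0),
      fun t ξ j => ?_⟩, fun ξ hξ t j => ?_⟩
  · simp only [Finset.sum_add_distrib, Sys.Qfun]
  · funext j
    rw [hg]
    refine Finset.sum_congr rfl fun t' _ => Finset.sum_congr rfl fun i _ => ?_
    exact eq_add_sum_step (hp t' i) (hw t' i) (by rw [hv]; exact hvEg t j t' i)
      (by rw [h0, hv]; exact hEg t j t' i) (hgapg t j t' i) (hmem ξ hξ t' i)
  · simp only [Finset.sum_add_distrib, Sys.Vfun]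
  · rw [hf, ← Finset.sum_sub_distrib]
    simp only [← Finset.sum_sub_distrib]
    calc _ ≤ ∑ t' ∈ Finset.univ.filter (· ≤ t), ∑ _i : Fin S.nxi, 2 * κ := by
          refine (Finset.abs_sum_le_sum_abs _ _).trans (Finset.sum_le_sum fun t' _ =>
            (Finset.abs_sum_le_sum_abs _ _).trans (Finset.sum_le_sum fun i _ => ?_))
          exact abs_interpolation_sub_le (hp t' i) (hw t' i)
            (by rw [h0, hv]; exact hEu t j t' i) (hgapu t j t' i) (hmem ξ hξ t' i)
      _ ≤ ∑ _t' : Fin S.T, ∑ _i : Fin S.nxi, 2 * κ :=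
          Finset.sum_le_sum_of_subset_of_nonneg (Finset.subset_univ _)
            fun _ _ _ => by positivity
      _ ≤ η := by simpa [mul_assoc] using hκη

/-- The state sequence as a function of the values of the controls along a trajectory. -/
def Sys.stateVal (S : Sys) (a : Fin S.T → Fin S.nu → ℝ) (g : Fin S.T → Fin S.ng → ℝ)
    (ξ : S.Traj) : ℕ → Fin S.nx → ℝ
  | 0 => S.xbar
  | t + 1 =>
    if h : t < S.T then
      (S.A ⟨t, h⟩).mulVec (S.stateVal a g ξ t) + (S.B ⟨t, h⟩).mulVec (a ⟨t, h⟩)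
        + (S.C ⟨t, h⟩).mulVec (g ⟨t, h⟩) + (S.Dm ⟨t, h⟩).mulVec (ξ ⟨t, h⟩)
    else S.xbar

/-- The total discounted cost as a function of the values of the controls along a trajectory. -/
def Sys.costVal (S : Sys)
    (x : (Fin S.T → Fin S.nu → ℝ) × (Fin S.T → Fin S.ng → ℝ) × S.Traj) : ℝ :=
  ∑ t : Fin S.T, S.α t * S.c t (S.stateVal x.1 x.2.1 x.2.2 (t : ℕ)) (x.1 t) (x.2.1 t)

/-- The left-hand side of the constraints as a function of the values of the controls along a
trajectory. -/
def Sys.consVal (S : Sys) (a : Fin S.T → Fin S.nu → ℝ) (g : Fin S.T → Fin S.ng → ℝ)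
    (ξ : S.Traj) (m : Fin S.nc) : ℝ :=
  ∑ t : Fin S.T, ((S.At t).mulVec (S.stateVal a g ξ (t : ℕ)) + (S.Bt t).mulVec (a t)
    + (S.Ct t).mulVec (g t) + (S.Dt t).mulVec (ξ t)) m

/-- The values of the controls along a trajectory, together with the trajectory. -/
def Sys.vals (S : Sys) (u : S.ContPol) (γ : S.IntPol) (ξ : S.Traj) :
    (Fin S.T → Fin S.nu → ℝ) × (Fin S.T → Fin S.ng → ℝ) × S.Traj :=
  (fun t => u t ξ, fun t k => (γ t ξ k : ℝ), ξ)

theorem Sys.state_eq_stateVal (S : Sys) (u : S.ContPol) (γ : S.IntPol) (ξ : S.Traj) (n : ℕ) :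
    S.state u γ ξ n = S.stateVal (fun t => u t ξ) (fun t k => (γ t ξ k : ℝ)) ξ n := by
  induction n with
  | zero => rfl
  | succ n ih => simp only [Sys.state, Sys.stateVal, ih]

theorem Sys.J_eq (S : Sys) (ℬ : Set (Measure S.Traj)) (u : S.ContPol) (γ : S.IntPol) :
    S.J ℬ u γ = ⨆ P ∈ ℬ, ((∫ ξ, S.costVal (S.vals u γ ξ) ∂P : ℝ) : EReal) := by
  simp only [Sys.J, Sys.state_eq_stateVal, Sys.costVal, Sys.vals]

theorem Sys.feas_iff (S : Sys) (u : S.ContPol) (γ : S.IntPol) :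
    S.Feas u γ ↔ ∀ ξ ∈ S.Xi, ∀ m,
      S.consVal (fun t => u t ξ) (fun t k => (γ t ξ k : ℝ)) ξ m ≤ S.q m := by
  simp only [Sys.Feas, Sys.state_eq_stateVal, Sys.consVal]

theorem Sys.stateVal_convex (S : Sys) (a a' : Fin S.T → Fin S.nu → ℝ)
    (g : Fin S.T → Fin S.ng → ℝ) (ξ : S.Traj) (r : ℝ) (n : ℕ) :
    S.stateVal ((1 - r) • a + r • a') g ξ n
      = (1 - r) • S.stateVal a g ξ n + r • S.stateVal a' g ξ n := by
  induction n with
  | zero => simp only [Sys.stateVal]; module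
  | succ n ih =>
    simp only [Sys.stateVal]
    split_ifs with h
    · simp only [ih, Pi.add_apply, Pi.smul_apply, Matrix.mulVec_add, Matrix.mulVec_smul]
      module
    · module

theorem Sys.consVal_convex (S : Sys) (a a' : Fin S.T → Fin S.nu → ℝ)
    (g : Fin S.T → Fin S.ng → ℝ) (ξ : S.Traj) (r : ℝ) (m : Fin S.nc) :
    S.consVal ((1 - r) • a + r • a') g ξ m
      = (1 - r) * S.consVal a g ξ m + r * S.consVal a' g ξ m := by
  simp only [Sys.consVal, Finset.mul_sum, ← Finset.sum_add_distrib]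
  refine Finset.sum_congr rfl fun t _ => ?_
  simp only [S.stateVal_convex, Pi.add_apply, Pi.smul_apply, Matrix.mulVec_add,
    Matrix.mulVec_smul, smul_eq_mul]
  ring

theorem Sys.continuous_stateVal (S : Sys) (n : ℕ) :
    Continuous fun x : (Fin S.T → Fin S.nu → ℝ) × (Fin S.T → Fin S.ng → ℝ) × S.Traj =>
      S.stateVal x.1 x.2.1 x.2.2 n := by
  induction n with
  | zero => exact continuous_const
  | succ n ih =>
    simp only [Sys.stateVal]
    split_ifs with h
    · refine (((continuous_const.matrix_mulVec ih).add
        (continuous_const.matrix_mulVec ?_)).add (continuous_const.matrix_mulVec ?_)).add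
        (continuous_const.matrix_mulVec ?_) <;> fun_prop
    · exact continuous_const

theorem Sys.continuous_costVal (S : Sys)
    (hc : ∀ t, Continuous (fun pr : (Fin S.nx → ℝ) × (Fin S.nu → ℝ) × (Fin S.ng → ℝ) =>
        S.c t pr.1 pr.2.1 pr.2.2)) : Continuous S.costVal := by
  refine continuous_finsetSum _ fun t _ => continuous_const.mul ?_
  exact (hc t).comp ((S.continuous_stateVal t).prodMk
    (((continuous_apply t).comp continuous_fst).prodMk
      ((continuous_apply t).comp (continuous_fst.comp continuous_snd))))

theorem Sys.isCompact_Xi (S : Sys) : IsCompact S.Xi := by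
  have : S.Xi = Set.univ.pi fun t => Set.univ.pi fun i => Set.Icc (S.l t i) (S.v t i) := by
    ext ξ; simp only [Sys.Xi, Set.mem_ofPred_eq, Set.mem_pi, Set.mem_univ, true_implies]
  rw [this]
  exact isCompact_univ_pi fun t => isCompact_univ_pi fun i => isCompact_Icc

theorem Sys.continuousOn_of_mem_Ncont (S : Sys) {u : S.ContPol} (hu : u ∈ S.Ncont) :
    ContinuousOn (fun ξ t => u t ξ) S.Xi := by
  obtain ⟨f, hfc, hf⟩ := hu
  refine continuousOn_pi.2 fun t => continuousOn_pi.2 fun j => ?_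
  simp only [hf]
  refine continuousOn_finsetSum _ fun t' _ => continuousOn_finsetSum _ fun i _ => ?_
  exact (hfc t j t' i).comp (by fun_prop) fun ξ hξ => hξ t' i

theorem Sys.measurable_of_mem_PiG (S : Sys) {b : S.Brk} {γ : S.IntPol} (hγ : γ ∈ S.PiG b) :
    Measurable fun ξ t k => (γ t ξ k : ℝ) := by
  obtain ⟨Z, z0, hγ⟩ := hγ
  refine measurable_pi_iff.2 fun t => measurable_pi_iff.2 fun k => ?_
  refine Measurable.comp (g := fun n : ℤ => (n : ℝ)) (measurable_of_countable _) ?_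
  simp only [hγ, Sys.Qfun]
  refine measurable_const.add (Finset.measurable_fun_sum _ fun t' _ =>
    Finset.measurable_fun_sum _ fun i _ => Finset.measurable_fun_sum _ fun m _ =>
      measurable_const.mul (Measurable.ite ?_ measurable_const measurable_const))
  exact measurableSet_le measurable_const (by fun_prop)

theorem Sys.exists_norm_le_of_mem_PiG (S : Sys) {b : S.Brk} {γ : S.IntPol} (hγ : γ ∈ S.PiG b) :
    ∃ R : ℝ, 0 ≤ R ∧ ∀ ξ, ‖fun t k => (γ t ξ k : ℝ)‖ ≤ R := by
  obtain ⟨Z, z0, hγ⟩ := hγ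
  set M : Fin S.T → Fin S.ng → ℝ := fun t j => |(z0 t j : ℝ)| +
    ∑ t' ∈ Finset.univ.filter (· ≤ t), ∑ i, ∑ k ∈ Finset.Icc 1 (b.p t' i - 1),
      |(Z t j t' i k : ℝ)| with hM
  have hM0 : ∀ t j, 0 ≤ M t j := fun t j => by positivity
  have hbound : ∀ t j ξ, |(γ t ξ j : ℝ)| ≤ M t j := by
    intro t j ξ
    rw [hγ]
    push_cast
    refine (abs_add_le _ _).trans (add_le_add le_rfl ?_)
    refine (Finset.abs_sum_le_sum_abs _ _).trans (Finset.sum_le_sum fun t' _ =>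
      (Finset.abs_sum_le_sum_abs _ _).trans (Finset.sum_le_sum fun i _ =>
        (Finset.abs_sum_le_sum_abs _ _).trans (Finset.sum_le_sum fun k _ => ?_)))
    rw [abs_mul]
    refine mul_le_of_le_one_right (abs_nonneg _) ?_
    unfold Sys.Qfun
    split_ifs <;> simp
  have hle : ∀ t j, M t j ≤ ∑ t, ∑ j, M t j := fun t j =>
    (Finset.single_le_sum (fun j _ => hM0 t j) (Finset.mem_univ j)).trans
      (Finset.single_le_sum (f := fun t => ∑ j, M t j)
        (fun t _ => Finset.sum_nonneg fun j _ => hM0 t j) (Finset.mem_univ t))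
  have hR0 : 0 ≤ ∑ t, ∑ j, M t j :=
    Finset.sum_nonneg fun t _ => Finset.sum_nonneg fun j _ => hM0 t j
  refine ⟨∑ t, ∑ j, M t j, hR0, fun ξ => ?_⟩
  refine (pi_norm_le_iff_of_nonneg hR0).2 fun t => (pi_norm_le_iff_of_nonneg hR0).2 fun j => ?_
  exact (hbound t j ξ).trans (hle t j)

theorem Sys.exists_norm_vals_le (S : Sys) (hlv : ∀ t i, S.l t i < S.v t i) {u : S.ContPol}
    (hu : u ∈ S.Ncont) {γ : S.IntPol} (hγ : γ ∈ S.Nint) :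
    ∃ R : ℝ, 0 ≤ R ∧ ∀ ξ ∈ S.Xi, ‖S.vals u γ ξ‖ ≤ R := by
  obtain ⟨b, ⟨γ', hγ', hγγ'⟩, -⟩ := S.exists_lift hlv hu hγ one_pos
  obtain ⟨R, hR, hγR⟩ := S.exists_norm_le_of_mem_PiG hγ'
  obtain ⟨R', hR'⟩ := S.isCompact_Xi.exists_bound_of_continuousOn
    ((S.continuousOn_of_mem_Ncont hu).prodMk continuousOn_id)
  refine ⟨max R R', hR.trans (le_max_left _ _), fun ξ hξ => ?_⟩
  have h1 := (norm_prod_le_iff.1 (hR' ξ hξ))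
  have h2 := hγR ξ
  simp only [hγγ' ξ hξ] at h2
  exact norm_prod_le_iff.2 ⟨h1.1.trans (le_max_right _ _), norm_prod_le_iff.2
    ⟨h2.trans (le_max_left _ _), h1.2.trans (le_max_right _ _)⟩⟩

theorem Sys.integrable_cost (S : Sys) (hlv : ∀ t i, S.l t i < S.v t i)
    (hc : ∀ t, Continuous (fun pr : (Fin S.nx → ℝ) × (Fin S.nu → ℝ) × (Fin S.ng → ℝ) =>
        S.c t pr.1 pr.2.1 pr.2.2))
    {P : Measure S.Traj} [IsProbabilityMeasure P] (hP : P S.Xiᶜ = 0) {u : S.ContPol}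
    (hu : u ∈ S.Ncont) {γ : S.IntPol} (hγ : γ ∈ S.Nint) :
    Integrable (fun ξ => S.costVal (S.vals u γ ξ)) P := by
  have hae : ∀ᵐ ξ ∂P, ξ ∈ S.Xi := by rwa [ae_iff]
  have hmeas := S.isCompact_Xi.measurableSet
  have hvals : AEMeasurable (S.vals u γ) P := by
    obtain ⟨b, ⟨γ', hγ', hγγ'⟩, -⟩ := S.exists_lift hlv hu hγ one_pos
    have hu' : AEMeasurable (fun ξ t => u t ξ) P := by
      rw [← Measure.restrict_eq_self_of_ae_mem hae]
      exact (S.continuousOn_of_mem_Ncont hu).aemeasurable hmeas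
    refine (hu'.prodMk ((S.measurable_of_mem_PiG hγ').prodMk
      measurable_id).aemeasurable).congr ?_
    filter_upwards [hae] with ξ hξ
    simp only [Sys.vals, hγγ' ξ hξ, id]
  obtain ⟨R, -, hR⟩ := S.exists_norm_vals_le hlv hu hγ
  obtain ⟨K, hK⟩ := (isCompact_closedBall (0 : (Fin S.T → Fin S.nu → ℝ) ×
    (Fin S.T → Fin S.ng → ℝ) × S.Traj) R).exists_bound_of_continuousOn
    (S.continuous_costVal hc).continuousOn
  refine Integrable.of_bound
    ((S.continuous_costVal hc).measurable.comp_aemeasurable hvals).aestronglyMeasurable K ?_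
  filter_upwards [hae] with ξ hξ
  exact hK _ (mem_closedBall_zero_iff.2 (hR ξ hξ))

theorem Sys.exists_cost_le_add (S : Sys) (hlv : ∀ t i, S.l t i < S.v t i)
    (hc : ∀ t, Continuous (fun pr : (Fin S.nx → ℝ) × (Fin S.nu → ℝ) × (Fin S.ng → ℝ) =>
        S.c t pr.1 pr.2.1 pr.2.2))
    {u : S.ContPol} (hu : u ∈ S.Ncont) {γ : S.IntPol} (hγ : γ ∈ S.Nint) {ε : ℝ} (hε : 0 < ε) :
    ∃ δ : ℝ, 0 < δ ∧ ∀ u' : S.ContPol, (∀ ξ ∈ S.Xi, ∀ t j, |u' t ξ j - u t ξ j| ≤ δ) →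
      ∀ ξ ∈ S.Xi, S.costVal (S.vals u' γ ξ) ≤ S.costVal (S.vals u γ ξ) + ε := by
  obtain ⟨R, -, hR⟩ := S.exists_norm_vals_le hlv hu hγ
  have huc := (isCompact_closedBall (0 : (Fin S.T → Fin S.nu → ℝ) ×
    (Fin S.T → Fin S.ng → ℝ) × S.Traj) (R + 1)).uniformContinuousOn_of_continuous
    (S.continuous_costVal hc).continuousOn
  obtain ⟨δ, hδ, hδc⟩ := Metric.uniformContinuousOn_iff.1 huc ε hε
  have hmin : 0 < min 1 (δ / 2) := lt_min one_pos (half_pos hδ)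
  refine ⟨min 1 (δ / 2), hmin, fun u' hu' ξ hξ => ?_⟩
  have hdist : dist (S.vals u' γ ξ) (S.vals u γ ξ) ≤ min 1 (δ / 2) := by
    refine max_le ?_ ?_
    · exact (dist_pi_le_iff hmin.le).2 fun t => (dist_pi_le_iff hmin.le).2 fun j => by
        rw [Real.dist_eq]; exact hu' ξ hξ t j
    · exact (dist_self (α := (Fin S.T → Fin S.ng → ℝ) × S.Traj) _).trans_le hmin.le
  have hu1 : ‖S.vals u γ ξ‖ ≤ R := hR ξ hξ
  have hu2 : ‖S.vals u' γ ξ‖ ≤ R + 1 := by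
    have h1 := norm_sub_norm_le (S.vals u' γ ξ) (S.vals u γ ξ)
    rw [dist_eq_norm] at hdist
    have h2 := min_le_left 1 (δ / 2)
    linarith
  have h := hδc _ (mem_closedBall_zero_iff.2 hu2) _
    (mem_closedBall_zero_iff.2 (hu1.trans (by linarith)))
    (hdist.trans_lt ((min_le_right _ _).trans_lt (by linarith)))
  rw [Real.dist_eq, abs_lt] at h
  linarith [h.2]

theorem Sys.J_le_add (S : Sys) (hlv : ∀ t i, S.l t i < S.v t i)
    (hc : ∀ t, Continuous (fun pr : (Fin S.nx → ℝ) × (Fin S.nu → ℝ) × (Fin S.ng → ℝ) =>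
        S.c t pr.1 pr.2.1 pr.2.2))
    {ℬ : Set (Measure S.Traj)} (hBprob : ∀ P ∈ ℬ, IsProbabilityMeasure P)
    (hBsupp : ∀ P ∈ ℬ, P S.Xiᶜ = 0) {u u' : S.ContPol} (hu : u ∈ S.Ncont) (hu' : u' ∈ S.Ncont)
    {γ γ' : S.IntPol} (hγ : γ ∈ S.Nint) (hγ' : γ' ∈ S.Nint) {ε : ℝ}
    (h : ∀ ξ ∈ S.Xi, S.costVal (S.vals u' γ' ξ) ≤ S.costVal (S.vals u γ ξ) + ε) :
    S.J ℬ u' γ' ≤ S.J ℬ u γ + ε := by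
  rw [S.J_eq, S.J_eq]
  refine iSup₂_le fun P hP => ?_
  have := hBprob P hP
  have hint := S.integrable_cost hlv hc (hBsupp P hP) hu hγ
  have hle : ∫ ξ, S.costVal (S.vals u' γ' ξ) ∂P ≤ (∫ ξ, S.costVal (S.vals u γ ξ) ∂P) + ε := by
    calc _ ≤ ∫ ξ, (S.costVal (S.vals u γ ξ) + ε) ∂P := by
          refine integral_mono_ae (S.integrable_cost hlv hc (hBsupp P hP) hu' hγ')
            (hint.add (integrable_const ε)) ?_
          have hae : ∀ᵐ ξ ∂P, ξ ∈ S.Xi := by rw [ae_iff]; exact hBsupp P hP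
          filter_upwards [hae] with ξ hξ using h ξ hξ
      _ = _ := by rw [integral_add hint (integrable_const ε)]; simp
  refine (EReal.coe_le_coe_iff.2 hle).trans ?_
  rw [EReal.coe_add]
  exact add_le_add (le_iSup₂ (f := fun (P : Measure S.Traj) (_ : P ∈ ℬ) =>
    ((∫ ξ, S.costVal (S.vals u γ ξ) ∂P : ℝ) : EReal)) P hP) le_rfl

theorem ereal_le_of_forall_pos_le_add {a b : EReal} (h : ∀ ε : ℝ, 0 < ε → a ≤ b + ε) : a ≤ b := by
  induction b with
  | bot => simpa using h 1 one_pos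
  | top => exact le_top
  | coe r =>
    induction a with
    | bot => exact bot_le
    | top => exact absurd (h 1 one_pos) (by rw [← EReal.coe_add]; exact (EReal.coe_lt_top _).not_ge)
    | coe s =>
      refine EReal.coe_le_coe_iff.2 (le_of_forall_pos_le_add fun ε hε => ?_)
      exact_mod_cast h ε hε

/-- Around any feasible policy pair there are feasible lifted policy pairs whose integer part is
the same on the support and whose continuous part is uniformly close. -/
theorem Sys.exists_feas_lift (S : Sys) (hnxi : 1 ≤ S.nxi)
    (hlv : ∀ t i, S.l t i < S.v t i)
    {u : S.ContPol} (hu : u ∈ S.Ncont) {γ : S.IntPol} (hγ : γ ∈ S.Nint) (hF : S.Feas u γ)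
    {u0 : S.ContPol} (hu0 : u0 ∈ S.Ncont) {ρ : ℝ} (hρ : 0 < ρ)
    (hball : ∀ u' ∈ S.Ncont, S.pdist u' u0 < ρ → S.Feas u' γ) {δ : ℝ} (hδ : 0 < δ) :
    ∃ b : S.Brk, ∃ u' ∈ S.PiU b, ∃ γ' ∈ S.PiG b, S.Feas u' γ' ∧
      (∀ ξ ∈ S.Xi, ∀ t, γ' t ξ = γ t ξ) ∧ ∀ ξ ∈ S.Xi, ∀ t j, |u' t ξ j - u t ξ j| ≤ δ := by
  obtain ⟨M, hM0, hM⟩ : ∃ M : ℝ, 0 < M ∧ ∀ ξ ∈ S.Xi, ∀ t j, |u0 t ξ j - u t ξ j| ≤ M := by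
    obtain ⟨M, hM⟩ := S.isCompact_Xi.exists_bound_of_continuousOn
      ((S.continuousOn_of_mem_Ncont hu0).sub (S.continuousOn_of_mem_Ncont hu))
    refine ⟨max M 1, lt_max_of_lt_right one_pos, fun ξ hξ t j => le_max_of_le_left ?_⟩
    exact ((norm_le_pi_norm (fun j => u0 t ξ j - u t ξ j) j).trans
      (norm_le_pi_norm (fun t j => u0 t ξ j - u t ξ j) t)).trans (hM ξ hξ)
  obtain ⟨r, hr0, hr1, hrM⟩ : ∃ r : ℝ, 0 < r ∧ r ≤ 1 ∧ r * M ≤ δ / 2 := by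
    refine ⟨min 1 (δ / 2 / M), by positivity, min_le_left _ _, ?_⟩
    exact (mul_le_mul_of_nonneg_right (min_le_right _ _) hM0.le).trans_eq
      (div_mul_cancel₀ _ hM0.ne')
  obtain ⟨κ, hκ, hκρ⟩ : ∃ κ : ℝ, 0 < κ ∧ (S.T * S.nu : ℝ) * κ < ρ := by
    refine ⟨ρ / (S.T * S.nu + 1), by positivity, ?_⟩
    rw [← mul_div_assoc, div_lt_iff₀ (by positivity)]
    linarith
  have hNr : (fun t ξ j => (1 - r) * u t ξ j + r * u0 t ξ j) ∈ S.Ncont := by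
    obtain ⟨f, hfc, hf⟩ := hu
    obtain ⟨f0, hfc0, hf0⟩ := hu0
    refine ⟨fun t j t' i x => (1 - r) * f t j t' i x + r * f0 t j t' i x,
      fun t j t' i => ((hfc t j t' i).const_smul (1 - r)).add
        ((hfc0 t j t' i).const_smul r), fun t ξ j => ?_⟩
    simp only [hf, hf0, Finset.sum_add_distrib, Finset.mul_sum]
  obtain ⟨b, ⟨γ', hγ', hγγ'⟩, u', hu', huu'⟩ := S.exists_lift hlv hNr hγ
    (lt_min (half_pos hδ) (mul_pos hr0 hκ))
  refine ⟨b, u', hu', γ', hγ', ?_, hγγ', fun ξ hξ t j => ?_⟩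
  · have hN' : (fun t ξ j => u0 t ξ j +
        r⁻¹ * (u' t ξ j - ((1 - r) * u t ξ j + r * u0 t ξ j))) ∈ S.Ncont := by
      obtain ⟨f, hfc, hf⟩ := hNr
      obtain ⟨f0, hfc0, hf0⟩ := hu0
      obtain ⟨f', hfc', hf'⟩ := S.PiU_subset_Ncont hnxi b hu'
      refine ⟨fun t j t' i x => f0 t j t' i x + r⁻¹ * (f' t j t' i x - f t j t' i x),
        fun t j t' i => (hfc0 t j t' i).add
          (((hfc' t j t' i).sub (hfc t j t' i)).const_smul r⁻¹), fun t ξ j => ?_⟩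
      have hft := hf t ξ j
      simp only at hft ⊢
      rw [hft, hf', hf0]
      simp only [Finset.sum_add_distrib, Finset.sum_sub_distrib, ← Finset.mul_sum]
    have hFeas := hball _ hN' <| by
      refine lt_of_le_of_lt ?_ hκρ
      calc _ ≤ ∑ _t : Fin S.T, ∑ _j : Fin S.nu, κ := by
            refine Finset.sum_le_sum fun t _ => Finset.sum_le_sum fun j _ =>
              Real.sSup_le ?_ hκ.le
            rintro _ ⟨ξ, hξ, rfl⟩
            simp only [add_sub_cancel_left, abs_mul, abs_inv, abs_of_pos hr0]
            rw [inv_mul_le_iff₀ hr0]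
            exact (huu' ξ hξ t j).trans (min_le_right _ _)
        _ = _ := by simp [mul_assoc]
    rw [Sys.feas_iff] at hFeas hF ⊢
    intro ξ hξ m
    have hconv : (fun t => u' t ξ) = (1 - r) • (fun t => u t ξ) + r • (fun t j => u0 t ξ j +
        r⁻¹ * (u' t ξ j - ((1 - r) * u t ξ j + r * u0 t ξ j))) := by
      funext t j
      simp only [Pi.add_apply, Pi.smul_apply, smul_eq_mul]
      field_simp
      ring
    simp only [hγγ' ξ hξ]
    rw [hconv, S.consVal_convex]
    have h1 := mul_le_mul_of_nonneg_left (hF ξ hξ m) (sub_nonneg.2 hr1)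
    have h2 := mul_le_mul_of_nonneg_left (hFeas ξ hξ m) hr0.le
    linarith
  · have h1 := (huu' ξ hξ t j).trans (min_le_left _ _)
    have h2 : |r * (u0 t ξ j - u t ξ j)| ≤ δ / 2 := by
      rw [abs_mul, abs_of_pos hr0]
      exact (mul_le_mul_of_nonneg_left (hM ξ hξ t j) hr0.le).trans hrM
    calc _ = |(u' t ξ j - ((1 - r) * u t ξ j + r * u0 t ξ j))
          + r * (u0 t ξ j - u t ξ j)| := by congr 1; ring
      _ ≤ _ := abs_add_le _ _
      _ ≤ δ := by linarith

/-- **Theorem 1: asymptotic performance of the lifted control policy.**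
If for every integer policy `γ ∈ 𝔑^γ` admitting a feasible continuous companion the
feasible set `𝔄(γ) ⊆ 𝔑ᵘ` has nonempty interior for the metric `d`, then the infimum of
the optimal values attained by lifted control policies over all breakpoint vectors
equals the optimal value over the additive policy classes `𝔑ᵘ × 𝔑^γ`. -/
theorem stmt_12 (S : Sys)
    (hT : 1 ≤ S.T) (hnx : 1 ≤ S.nx) (hnu : 1 ≤ S.nu) (hng : 1 ≤ S.ng)
    (hnxi : 1 ≤ S.nxi)
    (hlv : ∀ t i, S.l t i < S.v t i)
    (hc : ∀ t, Continuous (fun pr : (Fin S.nx → ℝ) × (Fin S.nu → ℝ) × (Fin S.ng → ℝ) =>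
        S.c t pr.1 pr.2.1 pr.2.2))
    (hα : ∀ t, S.α t ∈ Set.Icc (0 : ℝ) 1)
    (ℬ : Set (Measure S.Traj)) (hBne : ℬ.Nonempty)
    (hBprob : ∀ P ∈ ℬ, IsProbabilityMeasure P)
    (hBsupp : ∀ P ∈ ℬ, P S.Xiᶜ = 0)
    (hInterior : ∀ γpol ∈ S.Nint,
      (∃ upol ∈ S.Ncont, S.Feas upol γpol) →
      ∃ u0 ∈ S.Ncont, S.Feas u0 γpol ∧ ∃ ρ : ℝ, 0 < ρ ∧
        ∀ u' ∈ S.Ncont, S.pdist u' u0 < ρ → S.Feas u' γpol) :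
    (⨅ b : S.Brk, S.Jstar ℬ (S.PiU b) (S.PiG b)) = S.Jstar ℬ S.Ncont S.Nint := by
  refine le_antisymm (le_sInf ?_) (le_iInf fun b => ?_)
  · rintro _ ⟨⟨u, γ⟩, ⟨hu, hγ, hF⟩, rfl⟩
    obtain ⟨u0, hu0, -, ρ, hρ, hball⟩ := hInterior γ hγ ⟨u, hu, hF⟩
    refine ereal_le_of_forall_pos_le_add fun ε hε => ?_
    obtain ⟨δ, hδ, hcost⟩ := S.exists_cost_le_add hlv hc hu hγ hε
    obtain ⟨b, u', hu', γ', hγ', hF', hγγ', huu'⟩ :=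
      S.exists_feas_lift hnxi hlv hu hγ hF hu0 hρ hball hδ
    have hle : S.Jstar ℬ (S.PiU b) (S.PiG b) ≤ S.J ℬ u' γ' :=
      sInf_le ⟨(u', γ'), ⟨hu', hγ', hF'⟩, rfl⟩
    refine (iInf_le _ b).trans (hle.trans ?_)
    refine S.J_le_add hlv hc hBprob hBsupp hu (S.PiU_subset_Ncont hnxi b hu') hγ
      (S.PiG_subset_Nint hnxi b hγ') fun ξ hξ => ?_
    have h := hcost u' huu' ξ hξ
    simpa only [Sys.vals, hγγ' ξ hξ] using h
  · refine sInf_le_sInf (Set.image_mono ?_)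
    rintro ⟨u, γ⟩ ⟨hu, hγ, hF⟩
    exact ⟨S.PiU_subset_Ncont hnxi b hu, S.PiG_subset_Nint hnxi b hγ, hF⟩

end Stmt12
end

section
/- (Theorem 2, upper bound: non-asymptotic performance of the lifted control policy.) There exists a constant C, depending only on T, n_x, n_u, n_ξ, L_c, L_π and the matrices A_1,…,A_T, B_1,…,B_T, such that the following holds: for every breakpoint vector w, every π₀ ∈ Π^u(w), every ρ > 0, and every nonempty set 𝔅 of Borel probability measures on Ξ, if the ball 𝔠 = {π^u : d(π^u, π₀) ≤ ρ} satisfies 𝔑^u_{L_π} ∩ 𝔠 ≠ ∅, then inf_{π ∈ Π^u_{L_π}(w) ∩ 𝔠} J(π) − inf_{π ∈ 𝔑^u_{L_π} ∩ 𝔠} J(π) ≤ C·ε(w), where ε(w) = max_{t,i,j} (w_{t,i,j} − w_{t,i,j−1}) is the largest segment induced by w. -/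
open MeasureTheory

namespace Stmt15

/-- Disturbance trajectories. -/
abbrev Traj (T nxi : ℕ) : Type := Fin T → Fin nxi → ℝ

/-- Continuous control policies (causality is enforced by the policy classes below). -/
abbrev Pol (T nu nxi : ℕ) : Type := Fin T → Traj T nxi → Fin nu → ℝ

/-- The box support `Ξ`. -/
def Xi (T nxi : ℕ) (l v : Fin T → Fin nxi → ℝ) : Set (Traj T nxi) :=
  {ξ | ∀ t i, ξ t i ∈ Set.Icc (l t i) (v t i)}

/-- State sequence: index `0` carries `x₁ = x̄`, and for `t < T`,
`x (t+1) = A t (x t) + B t (u t ξ) + Dm t (ξ t)`. -/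
def state (T nx nu nxi : ℕ)
    (A : Fin T → Matrix (Fin nx) (Fin nx) ℝ)
    (B : Fin T → Matrix (Fin nx) (Fin nu) ℝ)
    (Dm : Fin T → Matrix (Fin nx) (Fin nxi) ℝ)
    (xbar : Fin nx → ℝ)
    (u : Pol T nu nxi) (ξ : Traj T nxi) : ℕ → Fin nx → ℝ
  | 0 => xbar
  | t + 1 =>
    if h : t < T then
      (A ⟨t, h⟩).mulVec (state T nx nu nxi A B Dm xbar u ξ t)
        + (B ⟨t, h⟩).mulVec (u ⟨t, h⟩ ξ)
        + (Dm ⟨t, h⟩).mulVec (ξ ⟨t, h⟩)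
    else xbar

/-- Worst-case expected cost over the ambiguity set `ℬ`. -/
noncomputable def J (T nx nu nxi : ℕ)
    (A : Fin T → Matrix (Fin nx) (Fin nx) ℝ)
    (B : Fin T → Matrix (Fin nx) (Fin nu) ℝ)
    (Dm : Fin T → Matrix (Fin nx) (Fin nxi) ℝ)
    (xbar : Fin nx → ℝ)
    (c : Fin T → (Fin nx → ℝ) → (Fin nu → ℝ) → ℝ)
    (ℬ : Set (Measure (Traj T nxi))) (u : Pol T nu nxi) : EReal :=
  ⨆ P ∈ ℬ,
    ((∫ ξ, ∑ t : Fin T,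
        c t (state T nx nu nxi A B Dm xbar u ξ (t : ℕ)) (u t ξ) ∂P : ℝ) : EReal)

/-- Optimal value over a class of policies (`⊤` if the class is empty). -/
noncomputable def Jstar (T nx nu nxi : ℕ)
    (A : Fin T → Matrix (Fin nx) (Fin nx) ℝ)
    (B : Fin T → Matrix (Fin nx) (Fin nu) ℝ)
    (Dm : Fin T → Matrix (Fin nx) (Fin nxi) ℝ)
    (xbar : Fin nx → ℝ)
    (c : Fin T → (Fin nx → ℝ) → (Fin nu → ℝ) → ℝ)
    (ℬ : Set (Measure (Traj T nxi))) (𝒜 : Set (Pol T nu nxi)) : EReal :=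
  sInf (J T nx nu nxi A B Dm xbar c ℬ '' 𝒜)

/-- Additive continuous control policies `𝔑ᵘ`. -/
def Ncont (T nu nxi : ℕ) (l v : Fin T → Fin nxi → ℝ) : Set (Pol T nu nxi) :=
  {u | ∃ f : Fin T → Fin nu → Fin T → Fin nxi → ℝ → ℝ,
    (∀ t j t' i, ContinuousOn (f t j t' i) (Set.Icc (l t' i) (v t' i))) ∧
    ∀ t ξ j, u t ξ j
      = ∑ t' ∈ Finset.univ.filter (· ≤ t), ∑ i, f t j t' i (ξ t' i)}

/-- A breakpoint vector `w`. -/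
structure Brk (T nxi : ℕ) (l v : Fin T → Fin nxi → ℝ) where
  p : Fin T → Fin nxi → ℕ
  hp : ∀ t i, 1 ≤ p t i
  w : Fin T → Fin nxi → ℕ → ℝ
  h0 : ∀ t i, w t i 0 = l t i
  hv : ∀ t i, w t i (p t i) = v t i
  hmono : ∀ t i j, j < p t i → w t i j < w t i (j + 1)

/-- Continuous components of the lifting induced by a breakpoint vector. -/
noncomputable def Vfun {T nxi : ℕ} {l v : Fin T → Fin nxi → ℝ}
    (b : Brk T nxi l v) (t : Fin T) (i : Fin nxi) (j : ℕ) (x : ℝ) : ℝ :=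
  if j = 1 then min x (b.w t i 1) else max (min x (b.w t i j) - b.w t i (j - 1)) 0

/-- Lifted continuous control policies `Πᵘ(w)`. -/
def PiU (T nu nxi : ℕ) (l v : Fin T → Fin nxi → ℝ) (b : Brk T nxi l v) :
    Set (Pol T nu nxi) :=
  {u | ∃ (Y : Fin T → Fin nu → Fin T → Fin nxi → ℕ → ℝ)
        (y0 : Fin T → Fin nu → ℝ),
    ∀ t ξ j, u t ξ j = y0 t j
      + ∑ t' ∈ Finset.univ.filter (· ≤ t), ∑ i,
          ∑ k ∈ Finset.Icc 1 (b.p t' i), Y t j t' i k * Vfun b t' i k (ξ t' i)}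

/-- All scalar components of the policy are `Lπ`-Lipschitz for the ℓ¹-norm on `Ξ_{[t]}`. -/
def LipPol (T nu nxi : ℕ) (l v : Fin T → Fin nxi → ℝ) (Lπ : ℝ)
    (u : Pol T nu nxi) : Prop :=
  ∀ t j, ∀ ξ ∈ Xi T nxi l v, ∀ ξ' ∈ Xi T nxi l v,
    |u t ξ j - u t ξ' j|
      ≤ Lπ * ∑ t' ∈ Finset.univ.filter (· ≤ t), ∑ i, |ξ t' i - ξ' t' i|

/-- The policy (pseudo-)distance `d(π₁, π₂) = Σ_t Σ_j sup_{ξ ∈ Ξ} |u¹_{t,j} − u²_{t,j}|`. -/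
noncomputable def pdist (T nu nxi : ℕ) (l v : Fin T → Fin nxi → ℝ)
    (u1 u2 : Pol T nu nxi) : ℝ :=
  ∑ t : Fin T, ∑ j : Fin nu,
    sSup ((fun ξ => |u1 t ξ j - u2 t ξ j|) '' Xi T nxi l v)

section Interpolation

variable {T nxi : ℕ} {l v : Fin T → Fin nxi → ℝ}

lemma Brk.w_mono (b : Brk T nxi l v) (t : Fin T) (i : Fin nxi) {m n : ℕ} (hmn : m ≤ n)
    (hn : n ≤ b.p t i) : b.w t i m ≤ b.w t i n := by
  induction n, hmn using Nat.le_induction with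
  | base => exact le_rfl
  | succ n _ ih => exact (ih (by omega)).trans (b.hmono t i n (by omega)).le

lemma Brk.w_mem (b : Brk T nxi l v) (t : Fin T) (i : Fin nxi) {n : ℕ} (hn : n ≤ b.p t i) :
    b.w t i n ∈ Set.Icc (l t i) (v t i) := by
  rw [← b.h0, ← b.hv]
  exact ⟨b.w_mono t i (Nat.zero_le n) hn, b.w_mono t i hn le_rfl⟩

lemma Brk.exists_segment (b : Brk T nxi l v) (t : Fin T) (i : Fin nxi) {x : ℝ}
    (hx : x ∈ Set.Icc (l t i) (v t i)) :
    ∃ k < b.p t i, x ∈ Set.Icc (b.w t i k) (b.w t i (k + 1)) := by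
  rw [← b.h0, ← b.hv] at hx
  have key : ∀ n, 1 ≤ n → n ≤ b.p t i → x ≤ b.w t i n →
      ∃ k < b.p t i, x ∈ Set.Icc (b.w t i k) (b.w t i (k + 1)) := by
    intro n hn
    induction n, hn using Nat.le_induction with
    | base => exact fun h1 h2 => ⟨0, h1, hx.1, h2⟩
    | succ n hn ih =>
      intro h1 h2
      rcases le_total x (b.w t i n) with h | h
      · exact ih (by omega) h
      · exact ⟨n, by omega, h, h2⟩
  exact key _ (b.hp t i) le_rfl hx.2

lemma Vfun_mono (b : Brk T nxi l v) (t : Fin T) (i : Fin nxi) (k : ℕ) :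
    Monotone (Vfun b t i k) := by
  intro x y hxy
  unfold Vfun
  split_ifs
  · exact min_le_min_right _ hxy
  · gcongr

lemma continuous_Vfun (b : Brk T nxi l v) (t : Fin T) (i : Fin nxi) (k : ℕ) :
    Continuous (Vfun b t i k) := by
  unfold Vfun
  split_ifs <;> fun_prop

lemma Vfun_sub_of_mem_segment (b : Brk T nxi l v) (t : Fin T) (i : Fin nxi) {k j : ℕ}
    (hk : k < b.p t i) (hj : j ∈ Finset.Icc 1 (b.p t i)) {x : ℝ}
    (hx : x ∈ Set.Icc (b.w t i k) (b.w t i (k + 1))) :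
    Vfun b t i j x = Vfun b t i j (b.w t i k) + if j = k + 1 then x - b.w t i k else 0 := by
  obtain ⟨hx1, hx2⟩ := hx
  obtain ⟨hj1, hj2⟩ := Finset.mem_Icc.1 hj
  have hkk := (b.hmono t i k hk).le
  rcases lt_trichotomy j (k + 1) with h | rfl | h
  · have hjk := b.w_mono t i (show j ≤ k by omega) hk.le
    rw [if_neg h.ne, add_zero]
    unfold Vfun
    split_ifs with h1
    · subst h1
      rw [min_eq_right (hjk.trans hx1), min_eq_right hjk]
    · rw [min_eq_right (hjk.trans hx1), min_eq_right hjk]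
  · unfold Vfun
    simp only [if_true, Nat.add_sub_cancel, min_eq_left hkk]
    split_ifs with h1
    · obtain rfl : k = 0 := by omega
      simp only [zero_add] at hx2 hkk
      rw [min_eq_left hx2, min_eq_left hkk]
      ring
    · rw [min_eq_left hx2, max_eq_left (by linarith), sub_self, max_self]
      ring
  · have hkj := b.w_mono t i (show k + 1 ≤ j by omega) hj2
    have hkj' := b.w_mono t i (show k + 1 ≤ j - 1 by omega) (by omega)
    rw [if_neg h.ne', add_zero]
    unfold Vfun
    rw [if_neg (by omega), if_neg (by omega), min_eq_left (hx2.trans hkj),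
      min_eq_left (hkk.trans hkj), max_eq_right (by linarith), max_eq_right (by linarith)]

/-- The univariate piecewise linear function with slopes `Y` on the segments of `b`. -/
noncomputable def liftSum (b : Brk T nxi l v) (t : Fin T) (i : Fin nxi) (Y : ℕ → ℝ)
    (x : ℝ) : ℝ :=
  ∑ k ∈ Finset.Icc 1 (b.p t i), Y k * Vfun b t i k x

lemma continuous_liftSum (b : Brk T nxi l v) (t : Fin T) (i : Fin nxi) (Y : ℕ → ℝ) :
    Continuous (liftSum b t i Y) :=
  continuous_finsetSum _ fun k _ => continuous_const.mul (continuous_Vfun b t i k)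

lemma liftSum_of_mem_segment (b : Brk T nxi l v) (t : Fin T) (i : Fin nxi) (Y : ℕ → ℝ) {k : ℕ}
    (hk : k < b.p t i) {x : ℝ} (hx : x ∈ Set.Icc (b.w t i k) (b.w t i (k + 1))) :
    liftSum b t i Y x = liftSum b t i Y (b.w t i k) + Y (k + 1) * (x - b.w t i k) := by
  unfold liftSum
  rw [Finset.sum_congr rfl fun j hj => by rw [Vfun_sub_of_mem_segment b t i hk hj hx]]
  simp only [mul_add, Finset.sum_add_distrib, mul_ite, mul_zero, Finset.sum_ite_eq']
  rw [if_pos (Finset.mem_Icc.2 ⟨by omega, hk⟩)]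

lemma exists_convexCombo (b : Brk T nxi l v) (t : Fin T) (i : Fin nxi) {x : ℝ}
    (hx : x ∈ Set.Icc (l t i) (v t i)) :
    ∃ k < b.p t i, ∃ θ ∈ Set.Icc (0 : ℝ) 1,
      x ∈ Set.Icc (b.w t i k) (b.w t i (k + 1)) ∧
      ∀ Y, liftSum b t i Y x
        = (1 - θ) * liftSum b t i Y (b.w t i k) + θ * liftSum b t i Y (b.w t i (k + 1)) := by
  obtain ⟨k, hk, hxk⟩ := b.exists_segment t i hx
  have hpos := sub_pos.2 (b.hmono t i k hk)
  have hx0 : x - b.w t i k = (x - b.w t i k) / (b.w t i (k + 1) - b.w t i k)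
      * (b.w t i (k + 1) - b.w t i k) := by field_simp
  refine ⟨k, hk, (x - b.w t i k) / (b.w t i (k + 1) - b.w t i k),
    ⟨div_nonneg (sub_nonneg.2 hxk.1) hpos.le, (div_le_one hpos).2 (by linarith [hxk.2])⟩,
    hxk, fun Y => ?_⟩
  rw [liftSum_of_mem_segment b t i Y hk hxk, liftSum_of_mem_segment b t i Y hk
    (Set.right_mem_Icc.2 (by linarith))]
  linear_combination Y (k + 1) * hx0

/-- The slopes of the piecewise linear interpolant of `f`. -/
noncomputable def slopes (b : Brk T nxi l v) (t : Fin T) (i : Fin nxi) (f : ℝ → ℝ) (k : ℕ) : ℝ :=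
  (f (b.w t i k) - f (b.w t i (k - 1))) / (b.w t i k - b.w t i (k - 1))

/-- The piecewise linear interpolant of `f` at the breakpoints. -/
noncomputable def interp (b : Brk T nxi l v) (t : Fin T) (i : Fin nxi) (f : ℝ → ℝ) (x : ℝ) : ℝ :=
  (f (l t i) - liftSum b t i (slopes b t i f) (l t i)) + liftSum b t i (slopes b t i f) x

lemma interp_w (b : Brk T nxi l v) (t : Fin T) (i : Fin nxi) (f : ℝ → ℝ) {k : ℕ}
    (hk : k ≤ b.p t i) : interp b t i f (b.w t i k) = f (b.w t i k) := by
  induction k with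
  | zero => simp [interp, b.h0]
  | succ k ih =>
    have hpos := sub_pos.2 (b.hmono t i k hk)
    have h := ih (by omega)
    unfold interp at h ⊢
    rw [liftSum_of_mem_segment b t i _ hk (Set.right_mem_Icc.2 (by linarith)), ← add_assoc, h]
    simp only [slopes, Nat.add_sub_cancel]
    field_simp
    ring

lemma exists_interp_convexCombo (b : Brk T nxi l v) (t : Fin T) (i : Fin nxi) {x : ℝ}
    (hx : x ∈ Set.Icc (l t i) (v t i)) (f : ℝ → ℝ) :
    ∃ k < b.p t i, ∃ θ ∈ Set.Icc (0 : ℝ) 1,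
      x ∈ Set.Icc (b.w t i k) (b.w t i (k + 1)) ∧
      interp b t i f x = (1 - θ) * f (b.w t i k) + θ * f (b.w t i (k + 1)) ∧
      ∀ Y, liftSum b t i Y x
        = (1 - θ) * liftSum b t i Y (b.w t i k) + θ * liftSum b t i Y (b.w t i (k + 1)) := by
  obtain ⟨k, hk, θ, hθ, hxk, hY⟩ := exists_convexCombo b t i hx
  refine ⟨k, hk, θ, hθ, hxk, ?_, hY⟩
  rw [← interp_w b t i f hk.le, ← interp_w b t i f hk]
  unfold interp
  rw [hY]
  ring

lemma convexCombo_le_or {θ a c : ℝ} (hθ : θ ∈ Set.Icc (0 : ℝ) 1) :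
    (1 - θ) * a + θ * c ≤ a ∨ (1 - θ) * a + θ * c ≤ c := by
  rcases le_total a c with h | h
  · right; nlinarith [hθ.1, hθ.2]
  · left; nlinarith [hθ.1, hθ.2]

/-- Interpolation error against a piecewise linear function is dominated at a breakpoint. -/
lemma exists_interp_sub_le (b : Brk T nxi l v) (t : Fin T) (i : Fin nxi) {x : ℝ}
    (hx : x ∈ Set.Icc (l t i) (v t i)) (f : ℝ → ℝ) (Y : ℕ → ℝ) :
    ∃ a ∈ Set.Icc (l t i) (v t i),
      interp b t i f x - liftSum b t i Y x ≤ f a - liftSum b t i Y a := by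
  obtain ⟨k, hk, θ, hθ, -, hf, hY⟩ := exists_interp_convexCombo b t i hx f
  rcases convexCombo_le_or (a := f (b.w t i k) - liftSum b t i Y (b.w t i k))
    (c := f (b.w t i (k + 1)) - liftSum b t i Y (b.w t i (k + 1))) hθ with h | h
  · exact ⟨_, b.w_mem t i hk.le, by rw [hf, hY]; linarith⟩
  · exact ⟨_, b.w_mem t i hk, by rw [hf, hY]; linarith⟩

lemma exists_le_interp_sub (b : Brk T nxi l v) (t : Fin T) (i : Fin nxi) {x : ℝ}
    (hx : x ∈ Set.Icc (l t i) (v t i)) (f : ℝ → ℝ) (Y : ℕ → ℝ) :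
    ∃ a ∈ Set.Icc (l t i) (v t i),
      f a - liftSum b t i Y a ≤ interp b t i f x - liftSum b t i Y x := by
  obtain ⟨k, hk, θ, hθ, -, hf, hY⟩ := exists_interp_convexCombo b t i hx f
  rcases convexCombo_le_or (a := -(f (b.w t i k) - liftSum b t i Y (b.w t i k)))
    (c := -(f (b.w t i (k + 1)) - liftSum b t i Y (b.w t i (k + 1)))) hθ with h | h
  · exact ⟨_, b.w_mem t i hk.le, by rw [hf, hY]; linarith⟩
  · exact ⟨_, b.w_mem t i hk, by rw [hf, hY]; linarith⟩

lemma liftSum_one_sub (b : Brk T nxi l v) (t : Fin T) (i : Fin nxi) {x y : ℝ}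
    (hx : x ∈ Set.Icc (l t i) (v t i)) (hy : y ∈ Set.Icc (l t i) (v t i)) :
    liftSum b t i 1 x - liftSum b t i 1 y = x - y := by
  have hw : ∀ k ≤ b.p t i,
      liftSum b t i 1 (b.w t i k) - b.w t i k = liftSum b t i 1 (l t i) - l t i := by
    intro k
    induction k with
    | zero => simp [b.h0]
    | succ k ih =>
      intro hk
      have h := ih (by omega)
      rw [liftSum_of_mem_segment b t i _ hk (Set.right_mem_Icc.2 (b.hmono t i k hk).le),
        Pi.one_apply]
      linarith
  have hc : ∀ z ∈ Set.Icc (l t i) (v t i),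
      liftSum b t i 1 z - z = liftSum b t i 1 (l t i) - l t i := by
    intro z hz
    obtain ⟨k, hk, hzk⟩ := b.exists_segment t i hz
    rw [liftSum_of_mem_segment b t i _ hk hzk, Pi.one_apply, ← hw k hk.le]
    ring
  linarith [hc x hx, hc y hy]

lemma abs_interp_sub_interp_le (b : Brk T nxi l v) (t : Fin T) (i : Fin nxi) {f : ℝ → ℝ} {L : ℝ}
    (hf : ∀ x ∈ Set.Icc (l t i) (v t i), ∀ y ∈ Set.Icc (l t i) (v t i),
      |f x - f y| ≤ L * |x - y|) {x y : ℝ}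
    (hx : x ∈ Set.Icc (l t i) (v t i)) (hy : y ∈ Set.Icc (l t i) (v t i)) :
    |interp b t i f x - interp b t i f y| ≤ L * |x - y| := by
  wlog hxy : y ≤ x generalizing x y
  · rw [abs_sub_comm, abs_sub_comm x]
    exact this hy hx (le_of_not_ge hxy)
  have hsl : ∀ k ∈ Finset.Icc 1 (b.p t i), |slopes b t i f k| ≤ L := by
    intro k hk
    obtain ⟨hk1, hk2⟩ := Finset.mem_Icc.1 hk
    have hpos : 0 < b.w t i k - b.w t i (k - 1) := by
      have := b.hmono t i (k - 1) (by omega)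
      rw [Nat.sub_add_cancel hk1] at this
      linarith
    have h := hf _ (b.w_mem t i hk2) _ (b.w_mem t i (show k - 1 ≤ b.p t i by omega))
    rw [slopes, abs_div, div_le_iff₀ (abs_pos.2 hpos.ne')]
    exact h
  calc |interp b t i f x - interp b t i f y|
      = |∑ k ∈ Finset.Icc 1 (b.p t i),
          slopes b t i f k * (Vfun b t i k x - Vfun b t i k y)| := by
        simp only [mul_sub, Finset.sum_sub_distrib]
        congr 1
        simp only [interp, liftSum]
        ring
    _ ≤ ∑ k ∈ Finset.Icc 1 (b.p t i), L * (Vfun b t i k x - Vfun b t i k y) := by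
        refine (Finset.abs_sum_le_sum_abs _ _).trans (Finset.sum_le_sum fun k hk => ?_)
        have hV := sub_nonneg.2 (Vfun_mono b t i k hxy)
        rw [abs_mul, abs_of_nonneg hV]
        exact mul_le_mul_of_nonneg_right (hsl k hk) hV
    _ = L * (liftSum b t i 1 x - liftSum b t i 1 y) := by
        simp [liftSum, ← Finset.mul_sum, Finset.sum_sub_distrib]
    _ = L * |x - y| := by
        rw [liftSum_one_sub b t i hx hy, abs_of_nonneg (sub_nonneg.2 hxy)]

lemma abs_interp_sub_le (b : Brk T nxi l v) (t : Fin T) (i : Fin nxi) {f : ℝ → ℝ} {L ε : ℝ}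
    (hL : 0 ≤ L)
    (hε : ∀ j, 1 ≤ j → j ≤ b.p t i → b.w t i j - b.w t i (j - 1) ≤ ε)
    (hf : ∀ x ∈ Set.Icc (l t i) (v t i), ∀ y ∈ Set.Icc (l t i) (v t i),
      |f x - f y| ≤ L * |x - y|) {x : ℝ} (hx : x ∈ Set.Icc (l t i) (v t i)) :
    |interp b t i f x - f x| ≤ L * ε := by
  obtain ⟨k, hk, θ, hθ, hxk, hfx, -⟩ := exists_interp_convexCombo b t i hx f
  have hseg := hε (k + 1) (by omega) hk
  rw [Nat.add_sub_cancel] at hseg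
  have h1 : |f (b.w t i k) - f x| ≤ L * ε :=
    (hf _ (b.w_mem t i hk.le) _ hx).trans (mul_le_mul_of_nonneg_left
      (abs_le.2 ⟨by linarith [hxk.2], by linarith [hxk.1, hxk.2]⟩) hL)
  have h2 : |f (b.w t i (k + 1)) - f x| ≤ L * ε :=
    (hf _ (b.w_mem t i hk) _ hx).trans (mul_le_mul_of_nonneg_left
      (abs_le.2 ⟨by linarith [hxk.1, hxk.2], by linarith [hxk.1]⟩) hL)
  rw [abs_le] at h1 h2 ⊢
  rw [hfx]
  constructor <;> nlinarith [hθ.1, hθ.2, h1.1, h1.2, h2.1, h2.2]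

end Interpolation

section Box

variable {T nxi : ℕ} {l v : Fin T → Fin nxi → ℝ}

lemma isCompact_Xi : IsCompact (Xi T nxi l v) := by
  have : Xi T nxi l v = Set.pi Set.univ fun t => Set.pi Set.univ fun i =>
      Set.Icc (l t i) (v t i) := by
    ext ξ
    simp only [Xi, Set.mem_ofPred_eq, Set.mem_pi, Set.mem_univ, true_imp_iff]
  rw [this]
  exact isCompact_univ_pi fun t => isCompact_univ_pi fun i => isCompact_Icc

lemma left_mem_Xi (hlv : ∀ t i, l t i < v t i) : l ∈ Xi T nxi l v :=
  fun t i => ⟨le_rfl, (hlv t i).le⟩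

lemma continuousOn_of_mem_Ncont {nu : ℕ} {u : Pol T nu nxi} (hu : u ∈ Ncont T nu nxi l v)
    (t : Fin T) (j : Fin nu) : ContinuousOn (fun ξ => u t ξ j) (Xi T nxi l v) := by
  obtain ⟨f, hf, hu⟩ := hu
  simp only [hu]
  refine continuousOn_finsetSum _ fun t' _ => continuousOn_finsetSum _ fun i _ => ?_
  exact (hf t j t' i).comp (by fun_prop) fun ξ hξ => hξ t' i

lemma continuous_of_mem_PiU {nu : ℕ} {b : Brk T nxi l v} {u : Pol T nu nxi}
    (hu : u ∈ PiU T nu nxi l v b) (t : Fin T) (j : Fin nu) : Continuous fun ξ => u t ξ j := by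
  obtain ⟨Y, y0, hu⟩ := hu
  simp only [hu]
  refine continuous_const.add (continuous_finsetSum _ fun t' _ => continuous_finsetSum _ fun i _ =>
    (continuous_liftSum b t' i (Y t j t' i)).comp (by fun_prop))

/-- The univariate terms of a Lipschitz additive policy are Lipschitz. -/
lemma LipPol.term_lipschitz {nu : ℕ} {Lπ : ℝ} (hlv : ∀ t i, l t i < v t i) {u : Pol T nu nxi}
    (hu : LipPol T nu nxi l v Lπ u) {f : Fin T → Fin nu → Fin T → Fin nxi → ℝ → ℝ}
    (hf : ∀ t ξ j, u t ξ j
      = ∑ t' ∈ Finset.univ.filter (· ≤ t), ∑ i, f t j t' i (ξ t' i))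
    {t t' : Fin T} (htt' : t' ≤ t) (j : Fin nu) (i : Fin nxi) :
    ∀ x ∈ Set.Icc (l t' i) (v t' i), ∀ y ∈ Set.Icc (l t' i) (v t' i),
      |f t j t' i x - f t j t' i y| ≤ Lπ * |x - y| := by
  intro x hx y hy
  let z : ℝ → Traj T nxi := fun a s k => if s = t' ∧ k = i then a else l s k
  have hz : ∀ a ∈ Set.Icc (l t' i) (v t' i), z a ∈ Xi T nxi l v := by
    intro a ha s k
    by_cases h : s = t' ∧ k = i
    · obtain ⟨rfl, rfl⟩ := h
      simpa [z] using ha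
    · simpa only [z, if_neg h] using left_mem_Xi hlv s k
  have hsum : ∀ g : Fin T → Fin nxi → ℝ, (∀ s k, ¬ (s = t' ∧ k = i) → g s k = 0) →
      ∑ s ∈ Finset.univ.filter (· ≤ t), ∑ k, g s k = g t' i := by
    intro g hg
    rw [Finset.sum_eq_single t', Finset.sum_eq_single i]
    · exact fun k _ hk => hg _ _ fun h => hk h.2
    · simp
    · exact fun s _ hs => Finset.sum_eq_zero fun k _ => hg _ _ fun h => hs h.1
    · simp [htt']
  have h := hu t j (z x) (hz x hx) (z y) (hz y hy)
  rw [hf, hf, ← Finset.sum_sub_distrib] at h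
  simp only [← Finset.sum_sub_distrib] at h
  rw [hsum _ fun s k hsk => by simp only [z, if_neg hsk, sub_self],
    hsum _ fun s k hsk => by simp only [z, if_neg hsk, sub_self, abs_zero]] at h
  simpa [z] using h

end Box

section LiftedPolicy

variable {T nu nxi : ℕ} {l v : Fin T → Fin nxi → ℝ}

/-- The policy obtained by interpolating every univariate term at the breakpoints. -/
noncomputable def interpPol (b : Brk T nxi l v)
    (f : Fin T → Fin nu → Fin T → Fin nxi → ℝ → ℝ) : Pol T nu nxi :=
  fun t ξ j => ∑ t' ∈ Finset.univ.filter (· ≤ t), ∑ i, interp b t' i (f t j t' i) (ξ t' i)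

lemma interpPol_mem_PiU (b : Brk T nxi l v) (f : Fin T → Fin nu → Fin T → Fin nxi → ℝ → ℝ) :
    interpPol b f ∈ PiU T nu nxi l v b := by
  refine ⟨fun t j t' i => slopes b t' i (f t j t' i),
    fun t j => ∑ t' ∈ Finset.univ.filter (· ≤ t), ∑ i,
      (f t j t' i (l t' i) - liftSum b t' i (slopes b t' i (f t j t' i)) (l t' i)),
    fun t ξ j => ?_⟩
  simp only [interpPol, interp, Finset.sum_add_distrib]
  rfl

variable {Lπ : ℝ} {u : Pol T nu nxi} {f : Fin T → Fin nu → Fin T → Fin nxi → ℝ → ℝ}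

lemma interpPol_lipPol (hlv : ∀ t i, l t i < v t i) (b : Brk T nxi l v)
    (hu : LipPol T nu nxi l v Lπ u)
    (hf : ∀ t ξ j, u t ξ j
      = ∑ t' ∈ Finset.univ.filter (· ≤ t), ∑ i, f t j t' i (ξ t' i)) :
    LipPol T nu nxi l v Lπ (interpPol b f) := by
  intro t j ξ hξ ξ' hξ'
  simp only [interpPol, ← Finset.sum_sub_distrib, Finset.mul_sum]
  refine (Finset.abs_sum_le_sum_abs _ _).trans (Finset.sum_le_sum fun t' ht' => ?_)
  refine (Finset.abs_sum_le_sum_abs _ _).trans (Finset.sum_le_sum fun i _ => ?_)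
  exact abs_interp_sub_interp_le b t' i
    (hu.term_lipschitz hlv hf (Finset.mem_filter.1 ht').2 j i) (hξ t' i) (hξ' t' i)

lemma abs_interpPol_sub_le (hlv : ∀ t i, l t i < v t i) (b : Brk T nxi l v) (hL : 0 ≤ Lπ)
    {ε : ℝ} (hε0 : 0 ≤ ε)
    (hε : ∀ t i j, 1 ≤ j → j ≤ b.p t i → b.w t i j - b.w t i (j - 1) ≤ ε)
    (hu : LipPol T nu nxi l v Lπ u)
    (hf : ∀ t ξ j, u t ξ j
      = ∑ t' ∈ Finset.univ.filter (· ≤ t), ∑ i, f t j t' i (ξ t' i))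
    (t : Fin T) (j : Fin nu) {ξ : Traj T nxi} (hξ : ξ ∈ Xi T nxi l v) :
    |interpPol b f t ξ j - u t ξ j| ≤ T * nxi * (Lπ * ε) := by
  rw [hf]
  simp only [interpPol, ← Finset.sum_sub_distrib]
  calc _ ≤ ∑ t' ∈ Finset.univ.filter (· ≤ t), ∑ _i : Fin nxi, Lπ * ε := by
        refine (Finset.abs_sum_le_sum_abs _ _).trans (Finset.sum_le_sum fun t' ht' => ?_)
        refine (Finset.abs_sum_le_sum_abs _ _).trans (Finset.sum_le_sum fun i _ => ?_)
        exact abs_interp_sub_le b t' i hL (hε t' i)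
          (hu.term_lipschitz hlv hf (Finset.mem_filter.1 ht').2 j i) (hξ t' i)
    _ ≤ ∑ _t' : Fin T, ∑ _i : Fin nxi, Lπ * ε :=
        Finset.sum_le_sum_of_subset_of_nonneg (Finset.filter_subset _ _)
          fun _ _ _ => Finset.sum_nonneg fun _ _ => mul_nonneg hL hε0
    _ = T * nxi * (Lπ * ε) := by
        simp [mul_assoc]

/-- Interpolation does not increase the distance to a lifted policy. -/
lemma pdist_interpPol_le (hlv : ∀ t i, l t i < v t i) (b : Brk T nxi l v)
    {u0 : Pol T nu nxi} (hu0 : u0 ∈ PiU T nu nxi l v b) (hu : u ∈ Ncont T nu nxi l v)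
    (hf : ∀ t ξ j, u t ξ j
      = ∑ t' ∈ Finset.univ.filter (· ≤ t), ∑ i, f t j t' i (ξ t' i)) :
    pdist T nu nxi l v (interpPol b f) u0 ≤ pdist T nu nxi l v u u0 := by
  refine Finset.sum_le_sum fun t _ => Finset.sum_le_sum fun j _ => ?_
  refine csSup_le (Set.Nonempty.image _ ⟨l, left_mem_Xi hlv⟩) ?_
  rintro _ ⟨ξ, hξ, rfl⟩
  have hbdd : BddAbove ((fun ξ => |u t ξ j - u0 t ξ j|) '' Xi T nxi l v) :=
    isCompact_Xi.bddAbove_image ((continuousOn_of_mem_Ncont hu t j).sub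
      (continuous_of_mem_PiU hu0 t j).continuousOn).abs
  obtain ⟨Y, y0, hY⟩ := hu0
  have hup : ∀ t' i, ∃ a ∈ Set.Icc (l t' i) (v t' i), interp b t' i (f t j t' i) (ξ t' i)
      - liftSum b t' i (Y t j t' i) (ξ t' i) ≤ f t j t' i a - liftSum b t' i (Y t j t' i) a :=
    fun t' i => exists_interp_sub_le b t' i (hξ t' i) _ _
  have hlo : ∀ t' i, ∃ a ∈ Set.Icc (l t' i) (v t' i), f t j t' i a
      - liftSum b t' i (Y t j t' i) a ≤ interp b t' i (f t j t' i) (ξ t' i)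
      - liftSum b t' i (Y t j t' i) (ξ t' i) :=
    fun t' i => exists_le_interp_sub b t' i (hξ t' i) _ _
  choose p hp hp' using hup
  choose q hq hq' using hlo
  have e1 : ∀ η : Traj T nxi, u t η j - u0 t η j
      = (∑ t' ∈ Finset.univ.filter (· ≤ t), ∑ i,
        (f t j t' i (η t' i) - liftSum b t' i (Y t j t' i) (η t' i))) - y0 t j := by
    intro η
    rw [hf, hY]
    simp only [Finset.sum_sub_distrib, liftSum]
    ring
  have e2 : interpPol b f t ξ j - u0 t ξ j
      = (∑ t' ∈ Finset.univ.filter (· ≤ t), ∑ i,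
        (interp b t' i (f t j t' i) (ξ t' i) - liftSum b t' i (Y t j t' i) (ξ t' i)))
        - y0 t j := by
    rw [hY]
    simp only [interpPol, Finset.sum_sub_distrib, liftSum]
    ring
  have hP : |u t p j - u0 t p j| ≤ _ := le_csSup hbdd ⟨p, hp, rfl⟩
  have hQ : |u t q j - u0 t q j| ≤ _ := le_csSup hbdd ⟨q, hq, rfl⟩
  rw [abs_le]
  constructor
  · refine (abs_le.1 hQ).1.trans ?_
    rw [e1, e2]
    exact sub_le_sub_right (Finset.sum_le_sum fun t' _ => Finset.sum_le_sum fun i _ => hq' t' i) _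
  · refine le_trans ?_ (abs_le.1 hP).2
    rw [e1, e2]
    exact sub_le_sub_right (Finset.sum_le_sum fun t' _ => Finset.sum_le_sum fun i _ => hp' t' i) _

end LiftedPolicy

section Cost

lemma sum_abs_mulVec_le {m n : ℕ} (M : Matrix (Fin m) (Fin n) ℝ) (x : Fin n → ℝ) :
    ∑ i, |M.mulVec x i| ≤ (∑ i, ∑ j, |M i j|) * ∑ j, |x j| := by
  rw [Finset.sum_mul]
  refine Finset.sum_le_sum fun i _ => ?_
  rw [Finset.sum_mul, Matrix.mulVec, dotProduct]
  refine (Finset.abs_sum_le_sum_abs _ _).trans (Finset.sum_le_sum fun j hj => ?_)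
  rw [abs_mul]
  exact mul_le_mul_of_nonneg_left (Finset.single_le_sum (fun k _ => abs_nonneg (x k)) hj)
    (abs_nonneg _)

/-- The state depends Lipschitz continuously on the controls, uniformly in the noise. -/
lemma exists_state_lipschitz (T nx nu nxi : ℕ) (A : Fin T → Matrix (Fin nx) (Fin nx) ℝ)
    (B : Fin T → Matrix (Fin nx) (Fin nu) ℝ) (n : ℕ) :
    ∃ K : ℝ, ∀ (Dm : Fin T → Matrix (Fin nx) (Fin nxi) ℝ) (xbar : Fin nx → ℝ)
      (u u' : Pol T nu nxi) (ξ : Traj T nxi) (δ : ℝ), 0 ≤ δ →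
      (∀ t j, |u t ξ j - u' t ξ j| ≤ δ) →
      ∑ i, |state T nx nu nxi A B Dm xbar u ξ n i - state T nx nu nxi A B Dm xbar u' ξ n i|
        ≤ K * δ := by
  induction n with
  | zero => exact ⟨0, fun Dm xbar u u' ξ δ _ _ => by simp [state]⟩
  | succ n ih =>
    obtain ⟨K, hK⟩ := ih
    by_cases h : n < T
    · refine ⟨(∑ i, ∑ j, |A ⟨n, h⟩ i j|) * K + (∑ i, ∑ j, |B ⟨n, h⟩ i j|) * nu,
        fun Dm xbar u u' ξ δ hδ hu => ?_⟩
      have hx := hK Dm xbar u u' ξ δ hδ hu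
      have hsum : ∑ j, |u ⟨n, h⟩ ξ j - u' ⟨n, h⟩ ξ j| ≤ nu * δ := by
        refine (Finset.sum_le_sum fun j _ => hu ⟨n, h⟩ j).trans ?_
        simp
      have hA := sum_abs_mulVec_le (A ⟨n, h⟩) (state T nx nu nxi A B Dm xbar u ξ n
        - state T nx nu nxi A B Dm xbar u' ξ n)
      have hB := sum_abs_mulVec_le (B ⟨n, h⟩) (u ⟨n, h⟩ ξ - u' ⟨n, h⟩ ξ)
      simp only [state, dif_pos h]
      calc _ ≤ ∑ i, (|(A ⟨n, h⟩).mulVec (state T nx nu nxi A B Dm xbar u ξ n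
                - state T nx nu nxi A B Dm xbar u' ξ n) i|
              + |(B ⟨n, h⟩).mulVec (u ⟨n, h⟩ ξ - u' ⟨n, h⟩ ξ) i|) := by
            refine Finset.sum_le_sum fun i _ => ?_
            refine le_trans (le_of_eq ?_) (abs_add_le _ _)
            simp only [Matrix.mulVec_sub, Pi.add_apply, Pi.sub_apply]
            congr 1
            ring
        _ ≤ (∑ i, ∑ j, |A ⟨n, h⟩ i j|) * (K * δ)
              + (∑ i, ∑ j, |B ⟨n, h⟩ i j|) * (nu * δ) := by
            rw [Finset.sum_add_distrib]
            exact add_le_add (hA.trans (mul_le_mul_of_nonneg_left hx (by positivity)))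
              (hB.trans (mul_le_mul_of_nonneg_left hsum (by positivity)))
        _ = _ := by ring
    · exact ⟨0, fun Dm xbar u u' ξ δ _ _ => by simp [state, h]⟩

variable {T nx nu nxi : ℕ} {l v : Fin T → Fin nxi → ℝ}
  {A : Fin T → Matrix (Fin nx) (Fin nx) ℝ} {B : Fin T → Matrix (Fin nx) (Fin nu) ℝ}
  {Dm : Fin T → Matrix (Fin nx) (Fin nxi) ℝ} {xbar : Fin nx → ℝ}
  {c : Fin T → (Fin nx → ℝ) → (Fin nu → ℝ) → ℝ}

lemma continuousOn_state {u : Pol T nu nxi} {s : Set (Traj T nxi)}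
    (hu : ∀ t j, ContinuousOn (fun ξ => u t ξ j) s) (n : ℕ) :
    ContinuousOn (fun ξ => state T nx nu nxi A B Dm xbar u ξ n) s := by
  induction n with
  | zero => exact continuousOn_const
  | succ n ih =>
    by_cases h : n < T
    · simp only [state, dif_pos h]
      refine ((Continuous.comp_continuousOn (g := (A ⟨n, h⟩).mulVec) (by fun_prop) ih).add
        (Continuous.comp_continuousOn (g := (B ⟨n, h⟩).mulVec) (by fun_prop)
          (continuousOn_pi.2 (hu ⟨n, h⟩)))).add
        (Continuous.comp_continuousOn (g := (Dm ⟨n, h⟩).mulVec) (by fun_prop) (by fun_prop))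
    · simp only [state, dif_neg h]
      exact continuousOn_const

lemma continuous_of_l1_lipschitz {g : (Fin nx → ℝ) → (Fin nu → ℝ) → ℝ} {L : ℝ}
    (hg : ∀ (x1 x2 : Fin nx → ℝ) (u1 u2 : Fin nu → ℝ),
      |g x1 u1 - g x2 u2| ≤ L * ((∑ i, |x1 i - x2 i|) + ∑ j, |u1 j - u2 j|)) :
    Continuous fun z : (Fin nx → ℝ) × (Fin nu → ℝ) => g z.1 z.2 := by
  rw [continuous_iff_continuousAt]
  intro z
  rw [ContinuousAt, tendsto_iff_dist_tendsto_zero]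
  have hlim : Filter.Tendsto (fun y : (Fin nx → ℝ) × (Fin nu → ℝ) =>
      L * ((∑ i, |y.1 i - z.1 i|) + ∑ j, |y.2 j - z.2 j|)) (nhds z) (nhds 0) := by
    have hc : Continuous fun y : (Fin nx → ℝ) × (Fin nu → ℝ) =>
      L * ((∑ i, |y.1 i - z.1 i|) + ∑ j, |y.2 j - z.2 j|) := by fun_prop
    simpa using hc.tendsto z
  exact squeeze_zero (fun _ => dist_nonneg) (fun y => hg y.1 z.1 y.2 z.2) hlim

lemma integrable_cost {Lc : ℝ}
    (hc : ∀ t (x1 x2 : Fin nx → ℝ) (u1 u2 : Fin nu → ℝ),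
      |c t x1 u1 - c t x2 u2| ≤ Lc * ((∑ i, |x1 i - x2 i|) + ∑ j, |u1 j - u2 j|))
    {P : Measure (Traj T nxi)} [IsProbabilityMeasure P] (hP : P (Xi T nxi l v)ᶜ = 0)
    {u : Pol T nu nxi} (hu : ∀ t j, ContinuousOn (fun ξ => u t ξ j) (Xi T nxi l v)) :
    Integrable (fun ξ => ∑ t : Fin T,
      c t (state T nx nu nxi A B Dm xbar u ξ (t : ℕ)) (u t ξ)) P := by
  have hcont : ContinuousOn (fun ξ => ∑ t : Fin T,
      c t (state T nx nu nxi A B Dm xbar u ξ (t : ℕ)) (u t ξ)) (Xi T nxi l v) :=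
    continuousOn_finsetSum _ fun t _ => (continuous_of_l1_lipschitz (hc t)).comp_continuousOn
      ((continuousOn_state hu t).prodMk (continuousOn_pi.2 (hu t)))
  have h := hcont.integrableOn_compact (μ := P) isCompact_Xi
  rwa [IntegrableOn, Measure.restrict_eq_self_of_ae_mem (by rwa [ae_iff])] at h

end Cost

/-- **Theorem 2, upper bound: non-asymptotic performance of the lifted
control policy.** There is a constant `C` depending only on `T, nx, nu, nxi, Lc, Lπ`
and the matrices `A, B` such that for every box support, every `Dm`, `x̄`, every family
of `Lc`-Lipschitz stage costs, every ambiguity set `ℬ`, every breakpoint vector `b`,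
every `π₀ ∈ Πᵘ(w)`, every radius `ρ > 0` and every bound `ε` on the segment lengths
of `b`: if the ball `𝔠 = {π : d(π, π₀) ≤ ρ}` meets `𝔑ᵘ_{Lπ}`, then
`inf_{π ∈ Πᵘ_{Lπ}(w) ∩ 𝔠} J(π) − inf_{π ∈ 𝔑ᵘ_{Lπ} ∩ 𝔠} J(π) ≤ C·ε`. -/
theorem stmt_15 (T nx nu nxi : ℕ)
    (hT : 1 ≤ T) (hnx : 1 ≤ nx) (hnu : 1 ≤ nu) (hnxi : 1 ≤ nxi)
    (A : Fin T → Matrix (Fin nx) (Fin nx) ℝ)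
    (B : Fin T → Matrix (Fin nx) (Fin nu) ℝ)
    (Lc Lπ : ℝ) (hLc : 0 ≤ Lc) (hLπ : 0 ≤ Lπ) :
    ∃ C : ℝ,
      ∀ (l v : Fin T → Fin nxi → ℝ), (∀ t i, l t i < v t i) →
      ∀ (Dm : Fin T → Matrix (Fin nx) (Fin nxi) ℝ) (xbar : Fin nx → ℝ)
        (c : Fin T → (Fin nx → ℝ) → (Fin nu → ℝ) → ℝ),
        (∀ t (x1 x2 : Fin nx → ℝ) (u1 u2 : Fin nu → ℝ),
          |c t x1 u1 - c t x2 u2|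
            ≤ Lc * ((∑ i, |x1 i - x2 i|) + ∑ j, |u1 j - u2 j|)) →
      ∀ ℬ : Set (Measure (Traj T nxi)), ℬ.Nonempty →
        (∀ P ∈ ℬ, IsProbabilityMeasure P) →
        (∀ P ∈ ℬ, P (Xi T nxi l v)ᶜ = 0) →
      ∀ b : Brk T nxi l v, ∀ π0 ∈ PiU T nu nxi l v b, ∀ ρ : ℝ, 0 < ρ →
      ∀ ε : ℝ, (∀ t i j, 1 ≤ j → j ≤ b.p t i → b.w t i j - b.w t i (j - 1) ≤ ε) →
      ({π ∈ Ncont T nu nxi l v | LipPol T nu nxi l v Lπ π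
          ∧ pdist T nu nxi l v π π0 ≤ ρ}).Nonempty →
      Jstar T nx nu nxi A B Dm xbar c ℬ
          {π ∈ PiU T nu nxi l v b | LipPol T nu nxi l v Lπ π
            ∧ pdist T nu nxi l v π π0 ≤ ρ}
        ≤ Jstar T nx nu nxi A B Dm xbar c ℬ
            {π ∈ Ncont T nu nxi l v | LipPol T nu nxi l v Lπ π
              ∧ pdist T nu nxi l v π π0 ≤ ρ}
          + ((C * ε : ℝ) : EReal) := by
  choose K hK using exists_state_lipschitz T nx nu nxi A B
  refine ⟨∑ t : Fin T, Lc * (K t * (T * nxi * Lπ) + nu * (T * nxi * Lπ)), ?_⟩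
  intro l v hlv Dm xbar c hc ℬ _ hprob hsupp b π0 hπ0 ρ _ ε hε _
  have hε0 : 0 ≤ ε := by
    have h1 := hε ⟨0, hT⟩ ⟨0, hnxi⟩ 1 le_rfl (b.hp _ _)
    have h2 := b.hmono ⟨0, hT⟩ ⟨0, hnxi⟩ 0 (b.hp _ _)
    simp only [Nat.sub_self, zero_add] at h1 h2
    linarith
  unfold Jstar
  rw [← EReal.sub_le_iff_le_add (Or.inl (EReal.coe_ne_bot _)) (Or.inl (EReal.coe_ne_top _))]
  refine le_sInf ?_
  rintro _ ⟨u, ⟨huN, huL, hud⟩, rfl⟩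
  rw [EReal.sub_le_iff_le_add (Or.inl (EReal.coe_ne_bot _)) (Or.inl (EReal.coe_ne_top _))]
  obtain ⟨f, -, hf⟩ := id huN
  have hmem := interpPol_mem_PiU b f
  have hclass : interpPol b f ∈ {π ∈ PiU T nu nxi l v b | LipPol T nu nxi l v Lπ π
      ∧ pdist T nu nxi l v π π0 ≤ ρ} :=
    ⟨hmem, interpPol_lipPol hlv b huL hf, (pdist_interpPol_le hlv b hπ0 huN hf).trans hud⟩
  refine (sInf_le (Set.mem_image_of_mem _ hclass)).trans ?_
  refine iSup₂_le fun P hP => ?_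
  have := hprob P hP
  refine le_trans ?_ (add_le_add_left (le_iSup₂ (f := fun P (_ : P ∈ ℬ) =>
    ((∫ ξ, ∑ t : Fin T,
      c t (state T nx nu nxi A B Dm xbar u ξ (t : ℕ)) (u t ξ) ∂P : ℝ) : EReal)) P hP) _)
  rw [← EReal.coe_add, EReal.coe_le_coe_iff]
  have hint := integrable_cost (A := A) (B := B) (Dm := Dm) (xbar := xbar) hc (hsupp P hP)
    (continuousOn_of_mem_Ncont huN)
  have hint' := integrable_cost (A := A) (B := B) (Dm := Dm) (xbar := xbar) hc (hsupp P hP)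
    fun t j => (continuous_of_mem_PiU hmem t j).continuousOn
  set C := ∑ t : Fin T, Lc * (K t * (T * nxi * Lπ) + nu * (T * nxi * Lπ)) with hC
  have hCint : ∫ _, C * ε ∂P = C * ε := by simp
  rw [← hCint, ← integral_add hint (integrable_const _)]
  refine integral_mono_ae hint' (hint.add (integrable_const _)) ?_
  have hae : ∀ᵐ ξ ∂P, ξ ∈ Xi T nxi l v := by
    rw [ae_iff]
    exact hsupp P hP
  filter_upwards [hae] with ξ hξ
  have hδ : ∀ t j, |interpPol b f t ξ j - u t ξ j| ≤ T * nxi * (Lπ * ε) :=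
    fun t j => abs_interpPol_sub_le hlv b hLπ hε0 hε huL hf t j hξ
  rw [← sub_le_iff_le_add', ← Finset.sum_sub_distrib, hC, Finset.sum_mul]
  refine Finset.sum_le_sum fun t _ => (le_abs_self _).trans ((hc t _ _ _ _).trans ?_)
  rw [mul_assoc]
  refine mul_le_mul_of_nonneg_left ?_ hLc
  have hx := hK t Dm xbar _ _ ξ _ (by positivity) hδ
  have hu : ∑ j, |interpPol b f t ξ j - u t ξ j| ≤ nu * (T * nxi * (Lπ * ε)) :=
    (Finset.sum_le_sum fun j _ => hδ t j).trans (by simp)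
  linarith

end Stmt15
end

section
/- (Tightness instance in Theorem 2.) Let ε > 0, L > 0, K > 0 and define c(x, u) = K·|u − L·|x − ε/2|| for x, u ∈ ℝ. Then: (i) for all a, b ∈ ℝ, (1/4)·c(0, a) + (1/2)·c(ε/2, (a+b)/2) + (1/4)·c(ε, b) ≥ K·L·ε/4; hence every controller that is affine on [0, ε] incurs expected cost at least K·L·ε/4 under the distribution (1/4)δ₀ + (1/2)δ_{ε/2} + (1/4)δ_ε. (ii) The function u*(ξ) = L·|ξ − ε/2| is L-Lipschitz on ℝ and satisfies (1/4)·c(0, u*(0)) + (1/2)·c(ε/2, u*(ε/2)) + (1/4)·c(ε, u*(ε)) = 0. -/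
/-- **tightness instance in Theorem 2.** For the cost
`c(x,u) = K·|u − L·|x − ε/2||`: (i) for all `a, b ∈ ℝ`,
`(1/4)c(0,a) + (1/2)c(ε/2,(a+b)/2) + (1/4)c(ε,b) ≥ K·L·ε/4`; hence every controller `u`
affine on `[0,ε]` (i.e. with `u(ε/2) = (u(0)+u(ε))/2`) incurs expected cost at least
`K·L·ε/4` under `(1/4)δ₀ + (1/2)δ_{ε/2} + (1/4)δ_ε`; (ii) `u*(ξ) = L·|ξ − ε/2|` is
`L`-Lipschitz on `ℝ` and its expected cost is `0`. -/
theorem stmt_16 (ε L K : ℝ) (hε : 0 < ε) (hL : 0 < L) (hK : 0 < K)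
    (c : ℝ → ℝ → ℝ) (hc : ∀ x u : ℝ, c x u = K * |u - L * abs (x - ε / 2)|)
    (ustar : ℝ → ℝ) (hustar : ∀ ξ : ℝ, ustar ξ = L * |ξ - ε / 2|) :
    (∀ a b : ℝ,
      K * L * ε / 4 ≤ (1/4) * c 0 a + (1/2) * c (ε/2) ((a + b)/2) + (1/4) * c ε b)
    ∧ (∀ u : ℝ → ℝ, u (ε/2) = (u 0 + u ε)/2 →
        K * L * ε / 4 ≤ (1/4) * c 0 (u 0) + (1/2) * c (ε/2) (u (ε/2)) + (1/4) * c ε (u ε))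
    ∧ (∀ x y : ℝ, |ustar x - ustar y| ≤ L * |x - y|)
    ∧ (1/4) * c 0 (ustar 0) + (1/2) * c (ε/2) (ustar (ε/2)) + (1/4) * c ε (ustar ε) = 0 := by
  have h0 : |0 - ε / 2| = ε / 2 := by
    rw [zero_sub, abs_neg, abs_of_pos (half_pos hε)]
  have hm : |ε / 2 - ε / 2| = 0 := by simp
  have h1 : |ε - ε / 2| = ε / 2 := by
    rw [sub_half, abs_of_pos (half_pos hε)]
  have key : ∀ a b : ℝ,
      K * L * ε / 4 ≤ (1/4) * c 0 a + (1/2) * c (ε/2) ((a + b)/2) + (1/4) * c ε b := by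
    intro a b
    rw [hc, hc, hc, h0, hm, h1]
    have h : L * ε / 4 ≤ (1/4) * |a - L * (ε / 2)| + (1/2) * |(a + b) / 2 - L * 0|
        + (1/4) * |b - L * (ε / 2)| := by
      linarith [neg_le_abs (a - L * (ε / 2)), le_abs_self ((a + b) / 2 - L * 0),
        neg_le_abs (b - L * (ε / 2))]
    linarith [mul_le_mul_of_nonneg_left h hK.le]
  refine ⟨key, fun u hu => hu ▸ key (u 0) (u ε), fun x y => ?_, by simp [hc, hustar]⟩
  rw [hustar, hustar, ← mul_sub, abs_mul, abs_of_pos hL]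
  refine mul_le_mul_of_nonneg_left ?_ hL.le
  simpa using abs_abs_sub_abs_le (x - ε / 2) (y - ε / 2)
end
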